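/- arXiv:1106.4251 — 5 statements merged into one kernel-verified Lean document; each statement's English description precedes it below -/
import Mathlib

section
/- (Smoothed weighting works for arbitrary distributions.) Let p be an arbitrary probability distribution on [n]×[m] and let p̃ denote its smoothed marginals. Let X̂_S = argmin{L̂_S(X) : X ∈ W_p̃}, the empirical risk minimizer over the p̃-weighted trace-norm ball. Then there is an absolute constant C such that, in expectation over a training sample S of size s drawn i.i.d. from p, E_S[L_p(X̂_S)] ≤ inf_{X ∈ W_p̃} L_p(X) + C · l · √(r·n·log(n)/s). -/
open scoped Classical
open Matrix Finset

noncomputable section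

/-- Trace norm (sum of singular values) of a real matrix. -/
def traceNorm {n m : ℕ} (X : Matrix (Fin n) (Fin m) ℝ) : ℝ :=
  ∑ j, Real.sqrt ((Matrix.isHermitian_conjTranspose_mul_self X).eigenvalues j)

/-- Weighted trace norm with row weights `pr` and column weights `pc`. -/
def wTrNorm {n m : ℕ} (pr : Fin n → ℝ) (pc : Fin m → ℝ)
    (X : Matrix (Fin n) (Fin m) ℝ) : ℝ :=
  traceNorm (Matrix.diagonal (fun i => Real.sqrt (pr i)) * X *
    Matrix.diagonal (fun j => Real.sqrt (pc j)))

/-- Weighted trace-norm ball of radius `√r`. -/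
def Wball {n m : ℕ} (pr : Fin n → ℝ) (pc : Fin m → ℝ) (r : ℝ) :
    Set (Matrix (Fin n) (Fin m) ℝ) :=
  {X | wTrNorm pr pc X ≤ Real.sqrt r}

/-- Row marginals of a distribution on `[n] × [m]`. -/
def rowMarg {n m : ℕ} (p : Matrix (Fin n) (Fin m) ℝ) (i : Fin n) : ℝ := ∑ j, p i j

/-- Column marginals of a distribution on `[n] × [m]`. -/
def colMarg {n m : ℕ} (p : Matrix (Fin n) (Fin m) ℝ) (j : Fin m) : ℝ := ∑ i, p i j

/-- `p` is a probability distribution on `[n] × [m]`. -/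
def IsDistrib {n m : ℕ} (p : Matrix (Fin n) (Fin m) ℝ) : Prop :=
  (∀ i j, 0 ≤ p i j) ∧ ∑ i, ∑ j, p i j = 1

/-- `ℓ` is `l`-Lipschitz in its first argument. -/
def LipLoss (l : ℝ) (ℓ : ℝ → ℝ → ℝ) : Prop :=
  ∀ x x' y, |ℓ x y - ℓ x' y| ≤ l * |x - x'|

/-- Probability of drawing the i.i.d. sample `S` from `p`. -/
def sampleProb {n m s : ℕ} (p : Matrix (Fin n) (Fin m) ℝ)
    (S : Fin s → Fin n × Fin m) : ℝ :=
  ∏ t, p (S t).1 (S t).2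

/-- Expectation over an i.i.d. sample of size `s` drawn from `p`. -/
def Esample {n m : ℕ} (s : ℕ) (p : Matrix (Fin n) (Fin m) ℝ)
    (f : (Fin s → Fin n × Fin m) → ℝ) : ℝ :=
  ∑ S : Fin s → Fin n × Fin m, sampleProb p S * f S

/-- Empirical risk of `X` on the sample `S` (target matrix `Y`, loss `ℓ`). -/
def empRisk {n m s : ℕ} (ℓ : ℝ → ℝ → ℝ) (Y : Matrix (Fin n) (Fin m) ℝ)
    (S : Fin s → Fin n × Fin m) (X : Matrix (Fin n) (Fin m) ℝ) : ℝ :=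
  (1 / (s : ℝ)) * ∑ t, ℓ (X (S t).1 (S t).2) (Y (S t).1 (S t).2)

/-- Population risk of `X` under sampling distribution `p`. -/
def popRisk {n m : ℕ} (p : Matrix (Fin n) (Fin m) ℝ) (ℓ : ℝ → ℝ → ℝ)
    (Y X : Matrix (Fin n) (Fin m) ℝ) : ℝ :=
  ∑ i, ∑ j, p i j * ℓ (X i j) (Y i j)

/-- Smoothed row marginals: `p̃^r(i) = p^r(i)/2 + 1/(2n)`. -/
def smoothR {n m : ℕ} (p : Matrix (Fin n) (Fin m) ℝ) (i : Fin n) : ℝ :=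
  rowMarg p i / 2 + 1 / (2 * (n : ℝ))

/-- Smoothed column marginals: `p̃^c(j) = p^c(j)/2 + 1/(2m)`. -/
def smoothC {n m : ℕ} (p : Matrix (Fin n) (Fin m) ℝ) (j : Fin m) : ℝ :=
  colMarg p j / 2 + 1 / (2 * (m : ℝ))


lemma aux_spec {ι : Type*} [Fintype ι] [DecidableEq ι] {A : Matrix ι ι ℝ} (hA : A.IsHermitian) :
    ∃ (U : Matrix ι ι ℝ) (a : ι → ℝ), U * Uᵀ = 1 ∧ Uᵀ * U = 1 ∧
      ∀ i : ℕ, A ^ i = U * diagonal (fun k => a k ^ i) * Uᵀ := by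
  refine ⟨(hA.eigenvectorUnitary : Matrix ι ι ℝ), hA.eigenvalues, ?_, ?_, ?_⟩
  · have := (Matrix.mem_unitaryGroup_iff).1 hA.eigenvectorUnitary.2
    simpa [star_eq_conjTranspose] using this
  · have := (Matrix.mem_unitaryGroup_iff').1 hA.eigenvectorUnitary.2
    simpa [star_eq_conjTranspose] using this
  · have h2 : (hA.eigenvectorUnitary : Matrix ι ι ℝ)ᵀ * (hA.eigenvectorUnitary : Matrix ι ι ℝ) = 1 := by
      have := (Matrix.mem_unitaryGroup_iff').1 hA.eigenvectorUnitary.2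
      simpa [star_eq_conjTranspose] using this
    have h1 : (hA.eigenvectorUnitary : Matrix ι ι ℝ) * (hA.eigenvectorUnitary : Matrix ι ι ℝ)ᵀ = 1 := by
      have := (Matrix.mem_unitaryGroup_iff).1 hA.eigenvectorUnitary.2
      simpa [star_eq_conjTranspose] using this
    have h3 : A = (hA.eigenvectorUnitary : Matrix ι ι ℝ) * diagonal hA.eigenvalues *
        (hA.eigenvectorUnitary : Matrix ι ι ℝ)ᵀ := by
      have := hA.spectral_theorem
      simpa [Unitary.conjStarAlgAut_apply, star_eq_conjTranspose, Function.comp_def] using this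
    generalize (hA.eigenvectorUnitary : Matrix ι ι ℝ) = U at *
    generalize hA.eigenvalues = a at *
    intro i
    induction i with
    | zero => simp [h1]
    | succ i ih =>
      rw [pow_succ, ih]
      nth_rewrite 1 [h3]
      calc _ = U * diagonal (fun k => a k ^ i) * (Uᵀ * U) * diagonal a * Uᵀ := by
            simp only [Matrix.mul_assoc]
        _ = _ := by
            rw [h2, Matrix.mul_one, Matrix.mul_assoc U, diagonal_mul_diagonal]
            simp only [pow_succ]

lemma aux_tr {ι : Type*} [Fintype ι] [DecidableEq ι] {A B : Matrix ι ι ℝ} (hA : A.IsHermitian)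
    (hB : B.IsHermitian) :
    ∃ (a b : ι → ℝ) (w : ι → ι → ℝ), (∀ k l, 0 ≤ w k l) ∧
      ∀ i j : ℕ, trace (A ^ i * B ^ j) = ∑ k, ∑ l, a k ^ i * b l ^ j * w k l := by
  obtain ⟨U, a, -, -, hU⟩ := aux_spec hA
  obtain ⟨V, b, -, -, hV⟩ := aux_spec hB
  refine ⟨a, b, fun k l => ((Uᵀ * V) k l) ^ 2, fun k l => sq_nonneg _, fun i j => ?_⟩
  rw [hU, hV]
  calc _ = trace (diagonal (fun k => a k ^ i) * (Uᵀ * V) * diagonal (fun k => b k ^ j) * (Uᵀ * V)ᵀ) := by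
        rw [Matrix.transpose_mul, Matrix.transpose_transpose, Matrix.mul_assoc U, Matrix.mul_assoc,
          Matrix.trace_mul_comm]
        simp only [Matrix.mul_assoc]
    _ = _ := by
        generalize Uᵀ * V = W
        simp only [trace, diag_apply]
        refine sum_congr rfl fun k _ => ?_
        rw [mul_apply]
        simp only [mul_diagonal, diagonal_mul, transpose_apply]
        refine sum_congr rfl fun l _ => ?_
        ring

lemma aux_scalar (a b : ℝ) (p : ℕ) :
    (a - b) * (a ^ (2*p+1) - b ^ (2*p+1)) ≤
      (2*p+1) * ((a - b)^2 * (a ^ (2*p) + b ^ (2*p))) := by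
  rw [← (Commute.all a b).geom_sum₂_mul]
  have key : ∑ i ∈ range (2*p+1), a ^ i * b ^ (2*p+1-1-i) ≤ (2*p+1) * (a ^ (2*p) + b ^ (2*p)) := by
    calc _ ≤ ∑ i ∈ range (2*p+1), (a ^ (2*p) + b ^ (2*p)) := by
          refine sum_le_sum fun i hi => ?_
          have hi' : i ≤ 2*p := by simp at hi; omega
          have e1 : a ^ (2*p) = |a| ^ (2*p) := by rw [pow_mul, pow_mul, sq_abs]
          have e2 : b ^ (2*p) = |b| ^ (2*p) := by rw [pow_mul, pow_mul, sq_abs]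
          rw [e1, e2]
          refine (le_abs_self _).trans ?_
          rw [abs_mul, abs_pow, abs_pow]
          have e3 : 2*p+1-1-i = 2*p - i := by omega
          rw [e3]
          rcases le_total (|a|) (|b|) with h | h
          · calc _ ≤ |b| ^ i * |b| ^ (2*p-i) := by gcongr
              _ = |b| ^ (2*p) := by rw [← pow_add]; congr 1; omega
              _ ≤ _ := by have := pow_nonneg (abs_nonneg a) (2*p); linarith
          · calc _ ≤ |a| ^ i * |a| ^ (2*p-i) := by gcongr
              _ = |a| ^ (2*p) := by rw [← pow_add]; congr 1; omega
              _ ≤ _ := by have := pow_nonneg (abs_nonneg b) (2*p); linarith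
      _ = _ := by simp; ring
  have := mul_le_mul_of_nonneg_left key (sq_nonneg (a - b))
  nlinarith [this]

lemma aux_trace_ineq {ι : Type*} [Fintype ι] [DecidableEq ι] {A B : Matrix ι ι ℝ}
    (hA : A.IsHermitian) (hB : B.IsHermitian) (p : ℕ) :
    trace ((A - B) * (A ^ (2*p+1) - B ^ (2*p+1))) ≤
      (2*p+1) * trace ((A - B)^2 * (A ^ (2*p) + B ^ (2*p))) := by
  obtain ⟨a, b, w, hw, h⟩ := aux_tr hA hB
  have e1 : trace ((A - B) * (A ^ (2*p+1) - B ^ (2*p+1))) =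
      trace (A ^ (2*p+2) * B ^ 0) - trace (A ^ 1 * B ^ (2*p+1)) - trace (A ^ (2*p+1) * B ^ 1)
        + trace (A ^ 0 * B ^ (2*p+2)) := by
    rw [trace_mul_comm (A ^ (2*p+1)) (B ^ 1)]
    simp only [pow_zero, pow_one, Matrix.mul_one, Matrix.one_mul, ← trace_sub, ← trace_add]
    congr 1
    rw [pow_succ' A (2*p+1), pow_succ' B (2*p+1)]
    noncomm_ring
  have e2 : trace ((A - B)^2 * (A ^ (2*p) + B ^ (2*p))) =
      trace (A ^ (2*p+2) * B ^ 0) - 2 * trace (A ^ (2*p+1) * B ^ 1) + trace (A ^ (2*p) * B ^ 2)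
      + trace (A ^ 2 * B ^ (2*p)) - 2 * trace (A ^ 1 * B ^ (2*p+1)) + trace (A ^ 0 * B ^ (2*p+2)) := by
    have x1 : (A - B)^2 * (A ^ (2*p) + B ^ (2*p)) = A ^ (2*p+2) - A * B * A ^ (2*p) - B * (A * A ^ (2*p))
       + B ^ 2 * A ^ (2*p) + A ^ 2 * B ^ (2*p) - A * (B * B ^ (2*p)) - B * A * B ^ (2*p)
       + B ^ (2*p+2) := by
      rw [show 2*p+2 = 2 + 2*p by ring, pow_add A 2, pow_add B 2]
      noncomm_ring
    rw [x1]
    simp only [trace_sub, trace_add]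
    rw [trace_mul_comm (A*B), ← Matrix.mul_assoc, ← pow_succ, ← pow_succ', ← pow_succ',
      trace_mul_comm B (A ^ _), trace_mul_comm (B ^ 2), Matrix.trace_mul_cycle B A, ← pow_succ,
      trace_mul_comm (B ^ (2*p+1)) A]
    simp only [pow_zero, pow_one, Matrix.mul_one, Matrix.one_mul]
    ring
  rw [e1, e2]
  simp only [h, mul_sum, ← sum_add_distrib, ← sum_sub_distrib]
  refine sum_le_sum fun k _ => sum_le_sum fun l _ => ?_
  have := mul_le_mul_of_nonneg_right (aux_scalar (a k) (b l) p) (hw k l)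
  refine le_of_eq_of_le ?_ (this.trans_eq ?_) <;> ring

def sg (b : Bool) : ℝ := if b then 1 else -1

lemma sg_not (b : Bool) : sg (!b) = - sg b := by cases b <;> simp [sg]
lemma sg_mul (b : Bool) : sg b * sg b = 1 := by cases b <;> simp [sg]

/-- Signed sum of matrices. -/
def Hs {ι : Type*} {s : ℕ} (A : Fin s → Matrix ι ι ℝ) (σ : Fin s → Bool) : Matrix ι ι ℝ :=
  ∑ t, sg (σ t) • A t

lemma Hs_herm {ι : Type*} {s : ℕ} {A : Fin s → Matrix ι ι ℝ} (hA : ∀ t, (A t).IsHermitian)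
    (σ : Fin s → Bool) : (Hs A σ).IsHermitian := by
  unfold Hs IsHermitian
  rw [conjTranspose_sum]
  refine sum_congr rfl fun t _ => ?_
  rw [conjTranspose_smul, hA t]; simp

def flipAt {s : ℕ} (t : Fin s) (σ : Fin s → Bool) : Fin s → Bool := Function.update σ t (!σ t)

lemma flipAt_inv {s : ℕ} (t : Fin s) : Function.Involutive (flipAt t) := by
  intro σ; simp [flipAt]

lemma Hs_flip {ι : Type*} {s : ℕ} (A : Fin s → Matrix ι ι ℝ) (σ : Fin s → Bool) (t : Fin s) :
    Hs A σ - Hs A (flipAt t σ) = (2 * sg (σ t)) • A t := by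
  unfold Hs
  rw [← sum_sub_distrib, Finset.sum_eq_single t]
  · simp only [flipAt, Function.update_self, sg_not]
    module
  · intro b _ hb
    simp [flipAt, Function.update_of_ne hb]
  · simp

lemma sum_flip {s : ℕ} (t : Fin s) (f : (Fin s → Bool) → ℝ) :
    ∑ σ, f (flipAt t σ) = ∑ σ, f σ :=
  Equiv.sum_comp (flipAt_inv t).toPerm f

lemma khin_step {ι : Type*} [Fintype ι] [DecidableEq ι] {s : ℕ} {A : Fin s → Matrix ι ι ℝ}
    (hA : ∀ t, (A t).IsHermitian) (p : ℕ) :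
    ∑ σ, trace (Hs A σ ^ (2*p+2)) ≤
      2 * (2*p+1) * ∑ σ, ∑ t, trace (A t ^ 2 * Hs A σ ^ (2*p)) := by
  have h1 : ∀ σ, trace (Hs A σ ^ (2*p+2)) = ∑ t, sg (σ t) * trace (A t * Hs A σ ^ (2*p+1)) := by
    intro σ
    rw [pow_succ']
    nth_rewrite 1 [Hs]
    rw [Matrix.sum_mul, trace_sum]
    simp
  simp only [h1]
  rw [sum_comm, sum_comm (γ := Fin s → Bool), mul_sum]
  refine sum_le_sum fun t _ => ?_
  have h2 : ∀ σ : Fin s → Bool, sg (σ t) * trace (A t * Hs A σ ^ (2*p+1)) +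
      sg (flipAt t σ t) * trace (A t * Hs A (flipAt t σ) ^ (2*p+1)) ≤
      2 * (2*p+1) * (trace (A t ^ 2 * Hs A σ ^ (2*p)) + trace (A t ^ 2 * Hs A (flipAt t σ) ^ (2*p))) := by
    intro σ
    have := aux_trace_ineq (Hs_herm hA σ) (Hs_herm hA (flipAt t σ)) p
    rw [Hs_flip, smul_pow, mul_pow, sq (sg _), sg_mul] at this
    simp only [smul_mul, trace_smul, mul_sub, mul_add, trace_sub, trace_add, smul_eq_mul] at this
    have e : sg (flipAt t σ t) = - sg (σ t) := by simp [flipAt, sg_not]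
    rw [e]
    linarith
  have h3 := sum_le_sum fun σ (_ : σ ∈ (univ : Finset (Fin s → Bool))) => h2 σ
  rw [sum_add_distrib, ← mul_sum, sum_add_distrib,
    sum_flip t (fun σ => trace (A t ^ 2 * Hs A σ ^ (2*p))),
    sum_flip t (fun σ => sg (σ t) * trace (A t * Hs A σ ^ (2*p+1)))] at h3
  linarith

lemma khin {ι : Type*} [Fintype ι] [DecidableEq ι] {s : ℕ} {A : Fin s → Matrix ι ι ℝ}
    (hA : ∀ t, (A t).IsHermitian) (d : ι → ℝ) (V : ℝ) (hd : ∑ t, A t ^ 2 = diagonal d)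
    (hV0 : 0 ≤ V) (hV : ∀ k, d k ≤ V) (P p : ℕ) (hp : p ≤ P) :
    ∑ σ, trace (Hs A σ ^ (2*p)) ≤ 2 ^ s * Fintype.card ι * (4 * P * V) ^ p := by
  induction p with
  | zero => simp
  | succ p ih =>
    refine (khin_step hA p).trans ?_
    have h1 : ∀ σ, ∑ t, trace (A t ^ 2 * Hs A σ ^ (2*p)) ≤ V * trace (Hs A σ ^ (2*p)) := by
      intro σ
      rw [← trace_sum, ← Matrix.sum_mul, hd]
      simp only [trace, diag_apply, diagonal_mul, mul_sum]
      refine sum_le_sum fun k _ => mul_le_mul_of_nonneg_right (hV k) ?_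
      have hh : (Hs A σ ^ p)ᵀ = Hs A σ ^ p := by
        have := (Hs_herm hA σ).pow p
        simpa [IsHermitian] using this
      rw [two_mul, pow_add, mul_apply]
      refine sum_nonneg fun l _ => ?_
      have : (Hs A σ ^ p) l k = (Hs A σ ^ p) k l := by
        conv_lhs => rw [← hh]
        rfl
      rw [this]; exact mul_self_nonneg _
    have h2 := ih (by omega)
    have hP : ((p:ℝ) + 1) ≤ P := by exact_mod_cast hp
    calc _ ≤ 2 * (2*p+1) * ∑ σ, V * trace (Hs A σ ^ (2*p)) := by
          gcongr with σ _; exact h1 σ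
      _ ≤ 2 * (2*p+1) * (V * (2 ^ s * Fintype.card ι * (4 * P * V) ^ p)) := by
          rw [← mul_sum]; gcongr
      _ ≤ 4 * P * (V * (2 ^ s * Fintype.card ι * (4 * P * V) ^ p)) := by
          gcongr ?_ * _
          linarith
      _ = _ := by ring

lemma quad_bound {ι : Type*} [Fintype ι] [DecidableEq ι] {H : Matrix ι ι ℝ}
    (hH : H.IsHermitian) {K : ℝ} (hK : 0 < K) (P : ℕ) (hP : 1 ≤ P) (x : ι → ℝ) :
    x ⬝ᵥ (H *ᵥ x) ≤ (K + K * (trace (H ^ (2*P)) / K ^ (2*P))) * (x ⬝ᵥ x) := by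
  obtain ⟨U, a, hU1, hU2, hU⟩ := aux_spec hH
  have ht : trace (H ^ (2*P)) = ∑ k, a k ^ (2*P) := by
    rw [hU, trace_mul_comm, ← Matrix.mul_assoc, hU2, Matrix.one_mul, trace_diagonal]
  have hak : ∀ k, a k ≤ K + K * (trace (H ^ (2*P)) / K ^ (2*P)) := by
    intro k
    have hnn : ∀ k, 0 ≤ a k ^ (2*P) := fun k => by rw [pow_mul']; positivity
    have h1 : a k ^ (2*P) ≤ trace (H ^ (2*P)) := by
      rw [ht]; exact single_le_sum (f := fun k => a k ^ (2*P)) (fun k _ => hnn k) (mem_univ k)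
    have h2 : a k ≤ K + K * (a k ^ (2*P) / K ^ (2*P)) := by
      rcases le_total (a k) K with h | h
      · have : 0 ≤ K * (a k ^ (2*P) / K ^ (2*P)) := by have := hnn k; positivity
        linarith
      · rw [← div_pow]
        have h3 : 1 ≤ a k / K := by rw [le_div_iff₀ hK]; linarith
        have h4 : a k / K ≤ (a k / K) ^ (2*P) := le_self_pow₀ h3 (by omega)
        have h5 : a k = K * (a k / K) := by field_simp
        nlinarith
    refine h2.trans ?_
    gcongr
  have e1 : x ⬝ᵥ (H *ᵥ x) = ∑ k, a k * ((Uᵀ *ᵥ x) k) ^ 2 := by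
    have := hU 1
    simp only [pow_one] at this
    rw [this, ← mulVec_mulVec, ← mulVec_mulVec, dotProduct_mulVec, ← mulVec_transpose]
    simp only [dotProduct, mulVec_diagonal]
    exact sum_congr rfl fun k _ => by ring
  have e2 : x ⬝ᵥ x = ∑ k, ((Uᵀ *ᵥ x) k) ^ 2 := by
    have : x ⬝ᵥ x = x ⬝ᵥ ((U * Uᵀ) *ᵥ x) := by rw [hU1, one_mulVec]
    rw [this, ← mulVec_mulVec, dotProduct_mulVec, ← mulVec_transpose]
    simp only [dotProduct]
    exact sum_congr rfl fun k _ => by ring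
  rw [e1, e2, mul_sum]
  exact sum_le_sum fun k _ => mul_le_mul_of_nonneg_right (hak k) (sq_nonneg _)

lemma tn_dual {n m : ℕ} {τ : Type*} [Fintype τ] (X : Matrix (Fin n) (Fin m) ℝ)
    (c : τ → ℝ) (z : τ → Fin n × Fin m) (K : ℝ)
    (hK : ∀ (u : Fin n → ℝ) (v : Fin m → ℝ), u ⬝ᵥ u = 1 → v ⬝ᵥ v = 1 →
      ∑ t, c t * (u (z t).1 * v (z t).2) ≤ K) :
    ∑ t, c t * X (z t).1 (z t).2 ≤ K * traceNorm X := by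
  unfold traceNorm
  set hX := Matrix.isHermitian_conjTranspose_mul_self X
  obtain ⟨U, hU⟩ : ∃ U, U = (hX.eigenvectorUnitary : Matrix (Fin m) (Fin m) ℝ) := ⟨_, rfl⟩
  have h1 : U * Uᵀ = 1 := by
    have := (Matrix.mem_unitaryGroup_iff).1 hX.eigenvectorUnitary.2
    rw [hU]; simpa [star_eq_conjTranspose] using this
  have h2 : Uᵀ * U = 1 := by
    have := (Matrix.mem_unitaryGroup_iff').1 hX.eigenvectorUnitary.2
    rw [hU]; simpa [star_eq_conjTranspose] using this
  have h3 : Xᵀ * X = U * diagonal hX.eigenvalues * Uᵀ := by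
    have := hX.spectral_theorem
    rw [hU]
    simpa [Unitary.conjStarAlgAut_apply, star_eq_conjTranspose, Function.comp_def] using this
  have h4 : (X * U)ᵀ * (X * U) = diagonal hX.eigenvalues := by
    calc _ = Uᵀ * (Xᵀ * X) * U := by rw [transpose_mul]; simp only [Matrix.mul_assoc]
      _ = (Uᵀ * U) * diagonal hX.eigenvalues * (Uᵀ * U) := by
        rw [h3]; simp only [Matrix.mul_assoc]
      _ = _ := by rw [h2]; simp
  generalize hX.eigenvalues = a at *
  have h5 : X = (X * U) * Uᵀ := by rw [Matrix.mul_assoc, h1, Matrix.mul_one]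
  generalize X * U = W at *
  have ha : ∀ j, (fun i => W i j) ⬝ᵥ (fun i => W i j) = a j := by
    intro j
    have := congrFun (congrFun h4 j) j
    simpa [mul_apply, dotProduct] using this
  have hu : ∀ j, (fun i => U i j) ⬝ᵥ (fun i => U i j) = 1 := by
    intro j
    have := congrFun (congrFun h2 j) j
    simpa [mul_apply, dotProduct] using this
  have e : ∑ t, c t * X (z t).1 (z t).2 = ∑ j, ∑ t, c t * (W (z t).1 j * U (z t).2 j) := by
    rw [sum_comm]
    refine sum_congr rfl fun t _ => ?_
    rw [h5, mul_apply, mul_sum]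
    rfl
  rw [e, mul_sum]
  refine sum_le_sum fun j _ => ?_
  have ha0 : 0 ≤ a j := by
    rw [← ha j]; exact sum_nonneg fun i _ => mul_self_nonneg _
  rcases ha0.eq_or_lt with h | h
  · have hz : ∀ i, W i j = 0 := by
      have := ha j
      rw [← h, dotProduct_self_eq_zero] at this
      exact fun i => congrFun this i
    simp [hz, ← h]
  · have hs : 0 < Real.sqrt (a j) := Real.sqrt_pos.2 h
    have := hK (fun i => W i j / Real.sqrt (a j)) (fun i => U i j) (by
      have h6 := ha j
      simp only [dotProduct] at h6 ⊢
      simp only [div_mul_div_comm, Real.mul_self_sqrt ha0, ← sum_div, h6]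
      exact div_self h.ne') (hu j)
    calc _ = (∑ t, c t * (W (z t).1 j / Real.sqrt (a j) * U (z t).2 j)) * Real.sqrt (a j) := by
          rw [sum_mul]
          refine sum_congr rfl fun t _ => ?_
          field_simp
      _ ≤ _ := mul_le_mul_of_nonneg_right this hs.le

/-- Dilation of a single entry. -/
def dil {n m : ℕ} (i : Fin n) (j : Fin m) (w : ℝ) : Matrix (Fin n ⊕ Fin m) (Fin n ⊕ Fin m) ℝ :=
  Matrix.single (Sum.inl i) (Sum.inr j) w + Matrix.single (Sum.inr j) (Sum.inl i) w

lemma dil_herm {n m : ℕ} (i : Fin n) (j : Fin m) (w : ℝ) : (dil i j w).IsHermitian := by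
  unfold dil IsHermitian
  rw [conjTranspose_add, conjTranspose_single, conjTranspose_single, add_comm]
  simp

lemma dil_sq {n m : ℕ} (i : Fin n) (j : Fin m) (w : ℝ) : dil i j w ^ 2 =
    diagonal (fun k => if k = Sum.inl i ∨ k = Sum.inr j then w ^ 2 else 0) := by
  unfold dil
  rw [sq, Matrix.add_mul, Matrix.mul_add, Matrix.mul_add]
  simp only [single_mul_single_same]
  rw [single_mul_single_of_ne _ _ _ _ (by simp), single_mul_single_of_ne _ _ _ _ (by simp)]
  ext a b
  simp only [zero_add, add_zero, Matrix.add_apply, single_apply, diagonal_apply]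
  rcases a with a | a <;> rcases b with b | b <;> simp <;> grind

lemma dil_quad {n m : ℕ} (i : Fin n) (j : Fin m) (w : ℝ) (u : Fin n → ℝ) (v : Fin m → ℝ) :
    (Sum.elim u v) ⬝ᵥ (dil i j w *ᵥ (Sum.elim u v)) = 2 * (w * (u i * v j)) := by
  unfold dil
  rw [add_mulVec, dotProduct_add, single_mulVec, single_mulVec]
  simp [dotProduct, Function.update_apply]
  ring

lemma rad_op {n m s : ℕ} (z : Fin s → Fin n × Fin m) (w : Fin n → Fin m → ℝ) (V : ℝ)
    (hV : 0 < V) (h1 : ∀ i, ∑ t, (if (z t).1 = i then w (z t).1 (z t).2 ^ 2 else 0) ≤ V)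
    (h2 : ∀ j, ∑ t, (if (z t).2 = j then w (z t).1 (z t).2 ^ 2 else 0) ≤ V)
    (P : ℕ) (hP : 1 ≤ P) (hPd : ((n : ℝ) + m) ≤ Real.exp P) :
    ∃ N : (Fin s → Bool) → ℝ, (∀ σ, 0 ≤ N σ) ∧ (∀ σ (u : Fin n → ℝ) (v : Fin m → ℝ), u ⬝ᵥ u = 1 → v ⬝ᵥ v = 1 →
      ∑ t, sg (σ t) * w (z t).1 (z t).2 * (u (z t).1 * v (z t).2) ≤ N σ) ∧
      ∑ σ, N σ ≤ 2 ^ s * (2 * Real.sqrt (4 * Real.exp 1 * P * V)) := by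
  set K := Real.sqrt (4 * Real.exp 1 * P * V) with hKdef
  have hP0 : (0:ℝ) < P := by exact_mod_cast hP
  have hKp : 0 < 4 * Real.exp 1 * P * V := by positivity
  have hK : 0 < K := Real.sqrt_pos.2 hKp
  have hK2 : K ^ (2 * P) = Real.exp P * (4 * P * V) ^ P := by
    rw [pow_mul, hKdef, Real.sq_sqrt hKp.le, ← Real.exp_one_pow, ← mul_pow]
    congr 1; ring
  set A : Fin s → Matrix (Fin n ⊕ Fin m) (Fin n ⊕ Fin m) ℝ :=
    fun t => dil (z t).1 (z t).2 (w (z t).1 (z t).2) with hAdef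
  have hA : ∀ t, (A t).IsHermitian := fun t => dil_herm _ _ _
  refine ⟨fun σ => K + K * (trace (Hs A σ ^ (2*P)) / K ^ (2*P)), ?_, ?_, ?_⟩
  · intro σ
    have : 0 ≤ trace (Hs A σ ^ (2*P)) := by
      have h := (posSemidef_conjTranspose_mul_self (Hs A σ ^ P)).trace_nonneg
      rwa [(Hs_herm hA σ).pow P, ← pow_add, ← two_mul] at h
    positivity
  · intro σ u v hu hv
    have hq := quad_bound (Hs_herm hA σ) hK P hP (Sum.elim u v)
    have e1 : Sum.elim u v ⬝ᵥ Sum.elim u v = 2 := by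
      have : Sum.elim u v ⬝ᵥ Sum.elim u v = u ⬝ᵥ u + v ⬝ᵥ v := by simp [dotProduct]
      rw [this, hu, hv]; norm_num
    have e2 : Sum.elim u v ⬝ᵥ (Hs A σ *ᵥ Sum.elim u v) =
        2 * ∑ t, sg (σ t) * w (z t).1 (z t).2 * (u (z t).1 * v (z t).2) := by
      unfold Hs
      rw [sum_mulVec, dotProduct_sum, mul_sum]
      refine sum_congr rfl fun t _ => ?_
      rw [smul_mulVec, dotProduct_smul, hAdef, dil_quad, smul_eq_mul]
      ring
    rw [e1, e2] at hq
    linarith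
  · have hk := khin hA (fun k => ∑ t, (if k = Sum.inl (z t).1 ∨ k = Sum.inr (z t).2 then
        w (z t).1 (z t).2 ^ 2 else 0)) V (by
        simp only [hAdef, dil_sq]
        ext a b
        rw [Matrix.sum_apply]
        by_cases hab : a = b
        · subst hab; simp
        · simp [hab]) hV.le (by
        rintro (i | j)
        · simpa [eq_comm] using h1 i
        · simpa [eq_comm] using h2 j) P P le_rfl
    rw [sum_add_distrib, ← mul_sum, ← sum_div]
    have hb : (0:ℝ) < (4 * P * V) ^ P := by positivity
    have h3 : (∑ σ, trace (Hs A σ ^ (2*P))) / K ^ (2*P) ≤ 2 ^ s := by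
      rw [div_le_iff₀ (by positivity), hK2]
      refine hk.trans ?_
      simp only [Fintype.card_sum, Fintype.card_fin, Nat.cast_add]
      rw [mul_assoc]
      gcongr
    have h4 := mul_le_mul_of_nonneg_left h3 hK.le
    simp only [sum_const, card_univ, Fintype.card_pi, Fintype.card_bool, prod_const, Fintype.card_fin,
      nsmul_eq_mul, Nat.cast_pow, Nat.cast_ofNat]
    linarith

lemma contr_step {κ : Type*} [Finite κ] [Nonempty κ] (a φ x : κ → ℝ) (l : ℝ)
    (h : ∀ k k', |φ k - φ k'| ≤ l * |x k - x k'|) :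
    (⨆ k, (a k + φ k)) + (⨆ k, (a k - φ k)) ≤ (⨆ k, (a k + l * x k)) + (⨆ k, (a k - l * x k)) := by
  obtain ⟨k, hk⟩ := exists_eq_ciSup_of_finite (f := fun k => a k + φ k)
  obtain ⟨k', hk'⟩ := exists_eq_ciSup_of_finite (f := fun k => a k - φ k)
  rw [← hk, ← hk']
  have b1 := fun k => le_ciSup (Set.finite_range fun k => a k + l * x k).bddAbove k
  have b2 := fun k => le_ciSup (Set.finite_range fun k => a k - l * x k).bddAbove k
  have h1 := (le_abs_self _).trans (h k k')
  have c1 := b1 k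
  have c2 := b1 k'
  have c3 := b2 k
  have c4 := b2 k'
  rcases le_total (x k) (x k') with hx | hx
  · rw [abs_of_nonpos (by linarith)] at h1
    nlinarith
  · rw [abs_of_nonneg (by linarith)] at h1
    nlinarith

lemma sum_cons_bool {s : ℕ} (f : (Fin (s+1) → Bool) → ℝ) :
    ∑ σ, f σ = ∑ σ : Fin s → Bool, (f (Fin.cons true σ) + f (Fin.cons false σ)) := by
  rw [← (Fin.consEquiv (fun _ => Bool)).sum_comp, Fintype.sum_prod_type, Fintype.sum_bool,
    sum_add_distrib]
  rfl

lemma contraction {κ : Type*} [Finite κ] [Nonempty κ] (l : ℝ) (s : ℕ) : ∀ (a : κ → ℝ)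
    (φ x : Fin s → κ → ℝ) (_ : ∀ t k k', |φ t k - φ t k'| ≤ l * |x t k - x t k'|),
    ∑ σ : Fin s → Bool, (⨆ k, (a k + ∑ t, sg (σ t) * φ t k)) ≤
      ∑ σ : Fin s → Bool, (⨆ k, (a k + ∑ t, sg (σ t) * (l * x t k))) := by
  induction s with
  | zero => intro a φ x h; simp
  | succ s ih =>
    intro a φ x h
    rw [sum_cons_bool, sum_cons_bool]
    simp only [Fin.sum_univ_succ, Fin.cons_zero, Fin.cons_succ, sg, if_true, one_mul,
      Bool.false_eq_true, if_false, neg_one_mul]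
    have h1 := ih (fun k => a k + φ 0 k) (fun t => φ t.succ) (fun t => x t.succ) (fun t => h _)
    have h2 := ih (fun k => a k - φ 0 k) (fun t => φ t.succ) (fun t => x t.succ) (fun t => h _)
    have h3 : ∀ σ : Fin s → Bool, _ := fun σ =>
      contr_step (fun k => a k + ∑ t : Fin s, sg (σ t) * (l * x t.succ k)) (φ 0) (x 0) l (h 0)
    have h4 := sum_le_sum fun σ (_ : σ ∈ (univ : Finset (Fin s → Bool))) => h3 σ
    simp only [sum_add_distrib, sg] at h1 h2 h4 ⊢
    simp only [sub_eq_add_neg, add_assoc, add_comm, add_left_comm] at h1 h2 h4 ⊢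
    linarith

lemma E_prod {Z : Type*} [Fintype Z] {s : ℕ} (g : Fin s → Z → ℝ) :
    ∑ S : Fin s → Z, ∏ t, g t (S t) = ∏ t, ∑ z, g t z := by
  classical
  rw [Finset.prod_univ_sum]
  simp

lemma E_one {Z : Type*} [Fintype Z] {s : ℕ} (q : Z → ℝ) (hq : ∑ z, q z = 1) :
    ∑ S : Fin s → Z, ∏ t, q (S t) = 1 := by
  rw [E_prod (fun _ => q)]; simp [hq]

lemma E_coord {Z : Type*} [Fintype Z] {s : ℕ} (q : Z → ℝ) (hq : ∑ z, q z = 1) (f : Z → ℝ)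
    (t : Fin s) : ∑ S : Fin s → Z, (∏ t, q (S t)) * f (S t) = ∑ z, q z * f z := by
  have : ∀ S : Fin s → Z, (∏ t, q (S t)) * f (S t) =
      ∏ u, (q (S u) * if u = t then f (S u) else 1) := by
    intro S
    rw [prod_mul_distrib, prod_ite_eq' univ t]; simp
  simp only [this]
  rw [E_prod (fun u z => q z * if u = t then f z else 1), prod_eq_single t]
  · simp
  · intro b _ hb; simp [hb, hq]
  · simp

lemma E_sum {Z : Type*} [Fintype Z] {s : ℕ} (q : Z → ℝ) (hq : ∑ z, q z = 1) (f : Z → ℝ) :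
    ∑ S : Fin s → Z, (∏ t, q (S t)) * ∑ t, f (S t) = s * ∑ z, q z * f z := by
  simp only [mul_sum]
  rw [sum_comm]
  simp only [E_coord q hq f, ← mul_sum]
  simp

lemma ciSup_add_le' {κ : Type*} [Finite κ] [Nonempty κ] (f g : κ → ℝ) :
    (⨆ k, (f k + g k)) ≤ (⨆ k, f k) + ⨆ k, g k :=
  ciSup_le fun k => add_le_add (le_ciSup (Set.finite_range f).bddAbove k)
    (le_ciSup (Set.finite_range g).bddAbove k)

def swp {Z : Type*} {s : ℕ} (σ : Fin s → Bool) (T : (Fin s → Z) × (Fin s → Z)) :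
    (Fin s → Z) × (Fin s → Z) :=
  (fun t => if σ t then T.1 t else T.2 t, fun t => if σ t then T.2 t else T.1 t)

lemma swp_inv {Z : Type*} {s : ℕ} (σ : Fin s → Bool) : Function.Involutive (swp (Z := Z) σ) := by
  intro T
  unfold swp
  ext t <;> cases h : σ t <;> simp [h]

lemma symmetrization {Z κ : Type*} [Fintype Z] [Finite κ] [Nonempty κ] {s : ℕ} (q : Z → ℝ)
    (hq0 : ∀ z, 0 ≤ q z) (hq : ∑ z, q z = 1) (F : κ → Z → ℝ) :
    2 ^ s * ∑ S : Fin s → Z, (∏ t, q (S t)) * ∑ S' : Fin s → Z, (∏ t, q (S' t)) *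
      (⨆ k, ∑ t, (F k (S' t) - F k (S t))) ≤
    2 * ∑ S : Fin s → Z, (∏ t, q (S t)) * ∑ σ : Fin s → Bool, ⨆ k, ∑ t, sg (σ t) * F k (S t) := by
  set Q : (Fin s → Z) → ℝ := fun S => ∏ t, q (S t) with hQ
  have hQ0 : ∀ S, 0 ≤ Q S := fun S => prod_nonneg fun t _ => hq0 _
  have hQ1 : ∑ S, Q S = 1 := E_one q hq
  set R : (Fin s → Bool) → (Fin s → Z) → ℝ := fun σ S => ⨆ k, ∑ t, sg (σ t) * F k (S t) with hR
  set Φ : (Fin s → Z) × (Fin s → Z) → ℝ := fun T => ⨆ k, ∑ t, (F k (T.2 t) - F k (T.1 t)) with hΦ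
  have e1 : ∑ S, Q S * ∑ S', Q S' * (⨆ k, ∑ t, (F k (S' t) - F k (S t))) =
      ∑ T : (Fin s → Z) × (Fin s → Z), Q T.1 * Q T.2 * Φ T := by
    rw [Fintype.sum_prod_type]
    refine sum_congr rfl fun S _ => ?_
    rw [mul_sum]
    exact sum_congr rfl fun S' _ => by rw [mul_assoc]
  have key : ∀ σ : Fin s → Bool, ∑ T : (Fin s → Z) × (Fin s → Z), Q T.1 * Q T.2 * Φ T ≤
      ∑ S, Q S * R σ S + ∑ S, Q S * R (fun t => !σ t) S := by
    intro σ
    rw [← Equiv.sum_comp ((swp_inv (Z := Z) σ).toPerm _)]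
    have hstep : ∀ T : (Fin s → Z) × (Fin s → Z),
        Q ((swp_inv (Z := Z) σ).toPerm _ T).1 * Q ((swp_inv (Z := Z) σ).toPerm _ T).2 * Φ ((swp_inv (Z := Z) σ).toPerm _ T) ≤
        Q T.1 * Q T.2 * (R σ T.2 + R (fun t => !σ t) T.1) := by
      intro T
      rw [Function.Involutive.coe_toPerm]
      have w : Q (swp σ T).1 * Q (swp σ T).2 = Q T.1 * Q T.2 := by
        simp only [hQ, swp, ← prod_mul_distrib]
        refine prod_congr rfl fun t _ => ?_
        cases σ t <;> simp [mul_comm]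
      rw [w]
      refine mul_le_mul_of_nonneg_left ?_ (mul_nonneg (hQ0 _) (hQ0 _))
      refine le_trans (le_of_eq ?_) (ciSup_add_le' _ _)
      simp only [hΦ]
      congr 1; ext k
      rw [← sum_add_distrib]
      refine sum_congr rfl fun t _ => ?_
      rw [sg_not]
      cases h : σ t <;> simp [swp, sg, h] <;> ring
    refine (sum_le_sum fun T _ => hstep T).trans (le_of_eq ?_)
    rw [Fintype.sum_prod_type]
    simp only [mul_add, sum_add_distrib]
    congr 1
    · simp only [mul_assoc, ← mul_sum]
      rw [← sum_mul, hQ1, one_mul]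
    · refine sum_congr rfl fun S _ => ?_
      simp only [← sum_mul, ← mul_sum, hQ1, mul_one]
  rw [e1]
  have h2 := sum_le_sum fun σ (_ : σ ∈ (univ : Finset (Fin s → Bool))) => key σ
  have hneg : ∑ σ : Fin s → Bool, ∑ S, Q S * R (fun t => !σ t) S = ∑ σ, ∑ S, Q S * R σ S := by
    have hi : Function.Involutive (fun (σ : Fin s → Bool) t => !σ t) := by
      intro σ; simp
    exact Equiv.sum_comp hi.toPerm (fun σ => ∑ S, Q S * R σ S)
  rw [sum_add_distrib, hneg] at h2
  simp only [sum_const, card_univ, Fintype.card_pi, Fintype.card_bool, prod_const, Fintype.card_fin,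
      nsmul_eq_mul, Nat.cast_pow, Nat.cast_ofNat] at h2
  refine h2.trans (le_of_eq ?_)
  rw [two_mul, sum_comm]
  simp only [mul_sum, hQ, hR]

lemma moment {Z ι : Type*} [Fintype Z] [Fintype ι] (s : ℕ) (q : Z → ℝ)
    (hq0 : ∀ z, 0 ≤ q z) (hq : ∑ z, q z = 1) (d : ι → Z → ℝ) (R μ : ℝ) (hR : 0 < R)
    (hd0 : ∀ k z, 0 ≤ d k z) (hd : ∀ k z, d k z ≤ R) (hμ : ∀ k, ∑ z, q z * d k z ≤ μ)
    (hμ0 : 0 ≤ μ) (hc : 1 < Real.log (Fintype.card ι)) :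
    ∃ V : (Fin s → Z) → ℝ, (∀ S, 0 < V S) ∧ (∀ S k, ∑ t, d k (S t) ≤ V S) ∧
      ∑ S, (∏ t, q (S t)) * V S ≤ R * Real.log (Fintype.card ι) + 2 * s * μ := by
  set Λ := Real.log (Fintype.card ι) with hΛ
  set a := Λ + 2 * s * μ / R with ha
  have hcard : (0:ℝ) < Fintype.card ι := by
    rcases (Nat.cast_nonneg (α := ℝ) (Fintype.card ι)).eq_or_lt with h | h
    · rw [hΛ, ← h, Real.log_zero] at hc; linarith
    · exact h
  have ha1 : 1 < a := by
    have : 0 ≤ 2 * s * μ / R := by positivity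
    linarith
  refine ⟨fun S => R * (a - 1 + ∑ k, Real.exp ((∑ t, d k (S t)) / R - a)), ?_, ?_, ?_⟩
  · intro S
    have : 0 ≤ ∑ k, Real.exp ((∑ t, d k (S t)) / R - a) := sum_nonneg fun k _ => (Real.exp_pos _).le
    have : 0 < a - 1 + ∑ k, Real.exp ((∑ t, d k (S t)) / R - a) := by linarith
    positivity
  · intro S k
    have h1 : Real.exp ((∑ t, d k (S t)) / R - a) ≤ ∑ k, Real.exp ((∑ t, d k (S t)) / R - a) :=
      single_le_sum (f := fun k => Real.exp ((∑ t, d k (S t)) / R - a))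
        (fun k _ => (Real.exp_pos _).le) (mem_univ k)
    have h2 := Real.add_one_le_exp ((∑ t, d k (S t)) / R - a)
    have h3 : (∑ t, d k (S t)) / R ≤ a - 1 + ∑ k, Real.exp ((∑ t, d k (S t)) / R - a) := by linarith
    rw [div_le_iff₀ hR] at h3
    linarith
  · have hexp : ∀ k, ∑ S : Fin s → Z, (∏ t, q (S t)) * Real.exp ((∑ t, d k (S t)) / R - a) ≤
        Real.exp (-Λ) := by
      intro k
      have e1 : ∀ S : Fin s → Z, (∏ t, q (S t)) * Real.exp ((∑ t, d k (S t)) / R - a) =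
          (∏ t, (q (S t) * Real.exp (d k (S t) / R))) * Real.exp (-a) := by
        intro S
        rw [prod_mul_distrib, ← Real.exp_sum, mul_assoc, ← Real.exp_add, sum_div, sub_eq_add_neg]
      simp only [e1, ← sum_mul]
      rw [E_prod (fun _ z => q z * Real.exp (d k z / R))]
      simp only [prod_const, card_univ, Fintype.card_fin]
      have e2 : ∑ z, q z * Real.exp (d k z / R) ≤ Real.exp (2 * μ / R) := by
        have e3 : ∀ z, q z * Real.exp (d k z / R) ≤ q z + 2 / R * (q z * d k z) := by
          intro z
          have h0 : 0 ≤ d k z / R := div_nonneg (hd0 k z) hR.le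
          have h1 : d k z / R ≤ 1 := by rw [div_le_one hR]; exact hd k z
          have := (le_abs_self _).trans (Real.abs_exp_sub_one_le (x := d k z / R) (by
            rw [abs_of_nonneg h0]; exact h1))
          rw [abs_of_nonneg h0] at this
          have h4 : Real.exp (d k z / R) ≤ 1 + 2 * (d k z / R) := by linarith
          calc _ ≤ q z * (1 + 2 * (d k z / R)) := mul_le_mul_of_nonneg_left h4 (hq0 z)
            _ = _ := by ring
        calc _ ≤ ∑ z, (q z + 2 / R * (q z * d k z)) := sum_le_sum fun z _ => e3 z
          _ = 1 + 2 / R * ∑ z, q z * d k z := by rw [sum_add_distrib, hq, mul_sum]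
          _ ≤ 1 + 2 / R * μ := by gcongr; exact hμ k
          _ = 2 * μ / R + 1 := by ring
          _ ≤ _ := Real.add_one_le_exp _
      have e0 : 0 ≤ ∑ z, q z * Real.exp (d k z / R) :=
        sum_nonneg fun z _ => mul_nonneg (hq0 z) (Real.exp_pos _).le
      calc _ ≤ Real.exp (2 * μ / R) ^ s * Real.exp (-a) := by gcongr
        _ = Real.exp (-Λ) := by
          rw [← Real.exp_nat_mul, ← Real.exp_add]; congr 1; rw [ha]; ring
    have hsum : ∑ S : Fin s → Z, (∏ t, q (S t)) *
        (R * (a - 1 + ∑ k, Real.exp ((∑ t, d k (S t)) / R - a))) =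
        R * (a - 1 + ∑ k, ∑ S : Fin s → Z, (∏ t, q (S t)) *
          Real.exp ((∑ t, d k (S t)) / R - a)) := by
      have : ∀ S : Fin s → Z, (∏ t, q (S t)) *
        (R * (a - 1 + ∑ k, Real.exp ((∑ t, d k (S t)) / R - a))) =
          R * ((∏ t, q (S t)) * (a - 1) + ∑ k, (∏ t, q (S t)) *
          Real.exp ((∑ t, d k (S t)) / R - a)) := by
        intro S; rw [← mul_sum]; ring
      simp only [this]
      rw [← mul_sum, sum_add_distrib, ← sum_mul, E_one q hq, one_mul, sum_comm]
    rw [hsum]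
    have h5 : ∑ k, ∑ S : Fin s → Z, (∏ t, q (S t)) *
          Real.exp ((∑ t, d k (S t)) / R - a) ≤ 1 := by
      calc _ ≤ ∑ k : ι, Real.exp (-Λ) := sum_le_sum fun k _ => hexp k
        _ = 1 := by
          rw [Real.exp_neg, hΛ, Real.exp_log hcard]
          simp [hcard.ne']
    calc _ ≤ R * (a - 1 + 1) := by gcongr
      _ = _ := by rw [ha]; field_simp; ring

lemma sqrt_jensen {α : Type*} [Fintype α] (q V : α → ℝ) (hq0 : ∀ x, 0 ≤ q x) (hq : ∑ x, q x = 1)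
    (hV : ∀ x, 0 ≤ V x) (b : ℝ) (hb : 0 < b) (h : ∑ x, q x * V x ≤ b) :
    ∑ x, q x * Real.sqrt (V x) ≤ Real.sqrt b := by
  have hs := Real.sqrt_pos.2 hb
  have h1 : ∀ x, q x * Real.sqrt (V x) * (2 * Real.sqrt b) ≤ q x * V x + q x * b := by
    intro x
    have := two_mul_le_add_sq (Real.sqrt (V x)) (Real.sqrt b)
    rw [Real.sq_sqrt (hV x), Real.sq_sqrt hb.le] at this
    nlinarith [mul_le_mul_of_nonneg_left this (hq0 x)]
  have h2 := sum_le_sum fun x (_ : x ∈ (univ : Finset α)) => h1 x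
  rw [← sum_mul, sum_add_distrib, ← sum_mul, hq] at h2
  have h3 := Real.mul_self_sqrt hb.le
  by_contra hc
  push Not at hc
  nlinarith

lemma rowMarg_nonneg {n m : ℕ} {p : Matrix (Fin n) (Fin m) ℝ} (hp : IsDistrib p) (i : Fin n) :
    0 ≤ rowMarg p i := sum_nonneg fun j _ => hp.1 i j
lemma colMarg_nonneg {n m : ℕ} {p : Matrix (Fin n) (Fin m) ℝ} (hp : IsDistrib p) (j : Fin m) :
    0 ≤ colMarg p j := sum_nonneg fun i _ => hp.1 i j

lemma smoothR_ge {n m : ℕ} {p : Matrix (Fin n) (Fin m) ℝ} (hp : IsDistrib p) (i : Fin n) :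
    1 / (2 * (n:ℝ)) ≤ smoothR p i := by
  have := rowMarg_nonneg hp i; unfold smoothR; linarith
lemma smoothC_ge {n m : ℕ} {p : Matrix (Fin n) (Fin m) ℝ} (hp : IsDistrib p) (j : Fin m) :
    1 / (2 * (m:ℝ)) ≤ smoothC p j := by
  have := colMarg_nonneg hp j; unfold smoothC; linarith
lemma smoothR_pos {n m : ℕ} {p : Matrix (Fin n) (Fin m) ℝ} (hp : IsDistrib p) (i : Fin n) :
    0 < smoothR p i := by
  have hn : (0:ℝ) < n := by exact_mod_cast i.pos
  exact lt_of_lt_of_le (by positivity) (smoothR_ge hp i)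
lemma smoothC_pos {n m : ℕ} {p : Matrix (Fin n) (Fin m) ℝ} (hp : IsDistrib p) (j : Fin m) :
    0 < smoothC p j := by
  have hn : (0:ℝ) < m := by exact_mod_cast j.pos
  exact lt_of_lt_of_le (by positivity) (smoothC_ge hp j)
lemma smoothR_inv {n m : ℕ} {p : Matrix (Fin n) (Fin m) ℝ} (hp : IsDistrib p) (i : Fin n) :
    1 / smoothR p i ≤ 2 * n := by
  have hn : (0:ℝ) < n := by exact_mod_cast i.pos
  have := smoothR_ge hp i
  rw [div_le_iff₀ (by positivity)] at this
  rw [div_le_iff₀ (smoothR_pos hp i)]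
  linarith
lemma smoothC_inv {n m : ℕ} {p : Matrix (Fin n) (Fin m) ℝ} (hp : IsDistrib p) (i : Fin m) :
    1 / smoothC p i ≤ 2 * m := by
  have hn : (0:ℝ) < m := by exact_mod_cast i.pos
  have := smoothC_ge hp i
  rw [div_le_iff₀ (by positivity)] at this
  rw [div_le_iff₀ (smoothC_pos hp i)]
  linarith
lemma rowMarg_div {n m : ℕ} {p : Matrix (Fin n) (Fin m) ℝ} (hp : IsDistrib p) (i : Fin n) :
    rowMarg p i / smoothR p i ≤ 2 := by
  rw [div_le_iff₀ (smoothR_pos hp i)]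
  unfold smoothR
  have : 0 ≤ 1 / (2 * (n:ℝ)) := by positivity
  linarith
lemma colMarg_div {n m : ℕ} {p : Matrix (Fin n) (Fin m) ℝ} (hp : IsDistrib p) (i : Fin m) :
    colMarg p i / smoothC p i ≤ 2 := by
  rw [div_le_iff₀ (smoothC_pos hp i)]
  unfold smoothC
  have : 0 ≤ 1 / (2 * (m:ℝ)) := by positivity
  linarith

/-- The entrywise weight. -/
def wt {n m : ℕ} (p : Matrix (Fin n) (Fin m) ℝ) (i : Fin n) (j : Fin m) : ℝ :=
  1 / (Real.sqrt (smoothR p i) * Real.sqrt (smoothC p j))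

lemma wt_sq {n m : ℕ} {p : Matrix (Fin n) (Fin m) ℝ} (hp : IsDistrib p) (i : Fin n) (j : Fin m) :
    wt p i j ^ 2 = 1 / smoothR p i * (1 / smoothC p j) := by
  unfold wt
  rw [div_pow, mul_pow, Real.sq_sqrt (smoothR_pos hp i).le, Real.sq_sqrt (smoothC_pos hp j).le]
  ring

lemma wt_mul {n m : ℕ} {p : Matrix (Fin n) (Fin m) ℝ} (hp : IsDistrib p)
    (X : Matrix (Fin n) (Fin m) ℝ) (i : Fin n) (j : Fin m) :
    wt p i j * ((Matrix.diagonal (fun i => Real.sqrt (smoothR p i)) * X *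
    Matrix.diagonal (fun j => Real.sqrt (smoothC p j))) i j) = X i j := by
  rw [mul_diagonal, diagonal_mul]
  unfold wt
  have h1 := Real.sqrt_pos.2 (smoothR_pos hp i)
  have h2 := Real.sqrt_pos.2 (smoothC_pos hp j)
  field_simp

/-- Linear functional bound on the ball. -/
lemma ball_dual {n m : ℕ} {p : Matrix (Fin n) (Fin m) ℝ} (hp : IsDistrib p) {r : ℝ}
    {τ : Type*} [Fintype τ] {X : Matrix (Fin n) (Fin m) ℝ}
    (hX : X ∈ Wball (smoothR p) (smoothC p) r)
    (c : τ → ℝ) (z : τ → Fin n × Fin m) (K : ℝ) (hK0 : 0 ≤ K)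
    (hK : ∀ (u : Fin n → ℝ) (v : Fin m → ℝ), u ⬝ᵥ u = 1 → v ⬝ᵥ v = 1 →
      ∑ t, c t * wt p (z t).1 (z t).2 * (u (z t).1 * v (z t).2) ≤ K) :
    ∑ t, c t * X (z t).1 (z t).2 ≤ K * Real.sqrt r := by
  have h := tn_dual (Matrix.diagonal (fun i => Real.sqrt (smoothR p i)) * X *
    Matrix.diagonal (fun j => Real.sqrt (smoothC p j))) (fun t => c t * wt p (z t).1 (z t).2) z K hK
  simp only [mul_assoc (c _), wt_mul hp X] at h
  exact h.trans (mul_le_mul_of_nonneg_left hX hK0)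

lemma ball_l1 {n m : ℕ} {p : Matrix (Fin n) (Fin m) ℝ} (hp : IsDistrib p) {r : ℝ}
    {X : Matrix (Fin n) (Fin m) ℝ} (hX : X ∈ Wball (smoothR p) (smoothC p) r) :
    ∑ i, ∑ j, p i j * |X i j| ≤ 2 * Real.sqrt r := by
  have := ball_dual hp hX (τ := Fin n × Fin m) (fun z => p z.1 z.2 * SignType.sign (X z.1 z.2))
    (fun z => z) 2 (by norm_num) (by
    intro u v hu hv
    have h1 : ∀ z : Fin n × Fin m, p z.1 z.2 * SignType.sign (X z.1 z.2) * wt p z.1 z.2 *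
        (u z.1 * v z.2) ≤ p z.1 z.2 * (u z.1 ^ 2 / smoothR p z.1) / 2 +
          p z.1 z.2 * (v z.2 ^ 2 / smoothC p z.2) / 2 := by
      intro z
      have e1 : u z.1 ^ 2 / smoothR p z.1 = (u z.1 / Real.sqrt (smoothR p z.1)) ^ 2 := by
        rw [div_pow, Real.sq_sqrt (smoothR_pos hp _).le]
      have e2 : v z.2 ^ 2 / smoothC p z.2 = (v z.2 / Real.sqrt (smoothC p z.2)) ^ 2 := by
        rw [div_pow, Real.sq_sqrt (smoothC_pos hp _).le]
      have e3 : p z.1 z.2 * SignType.sign (X z.1 z.2) * wt p z.1 z.2 * (u z.1 * v z.2) =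
          p z.1 z.2 * (SignType.sign (X z.1 z.2) * ((u z.1 / Real.sqrt (smoothR p z.1)) *
            (v z.2 / Real.sqrt (smoothC p z.2)))) := by
        unfold wt; field_simp
      rw [e1, e2, e3]
      generalize u z.1 / Real.sqrt (smoothR p z.1) = a
      generalize v z.2 / Real.sqrt (smoothC p z.2) = b
      have h3 : (SignType.sign (X z.1 z.2) : ℝ) * (a * b) ≤ (a ^ 2 + b ^ 2) / 2 := by
        rcases lt_trichotomy (X z.1 z.2) 0 with h | h | h
        · rw [sign_neg h]; simp only [SignType.coe_neg_one, SignType.coe_one, SignType.coe_zero]; nlinarith [sq_nonneg (a + b)]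
        · rw [h, sign_zero]; simp only [SignType.coe_neg_one, SignType.coe_one, SignType.coe_zero]; nlinarith [sq_nonneg a, sq_nonneg b]
        · rw [sign_pos h]; simp only [SignType.coe_neg_one, SignType.coe_one, SignType.coe_zero]; nlinarith [sq_nonneg (a - b)]
      have := mul_le_mul_of_nonneg_left h3 (hp.1 z.1 z.2)
      linarith
    refine (sum_le_sum fun z _ => h1 z).trans ?_
    rw [sum_add_distrib, ← sum_div, ← sum_div, Fintype.sum_prod_type, Fintype.sum_prod_type_right]
    simp only [← sum_mul]
    have a1 : ∑ i, (∑ j, p i j) * (u i ^ 2 / smoothR p i) ≤ 2 := by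
      calc _ ≤ ∑ i, 2 * (u i * u i) := by
            refine sum_le_sum fun i _ => ?_
            have := mul_le_mul_of_nonneg_right (rowMarg_div hp i) (mul_self_nonneg (u i))
            refine le_trans (le_of_eq ?_) this
            unfold rowMarg; ring
        _ = 2 := by rw [← mul_sum]; unfold dotProduct at hu; rw [hu]; norm_num
    have a2 : ∑ i, (∑ j, p j i) * (v i ^ 2 / smoothC p i) ≤ 2 := by
      calc _ ≤ ∑ i, 2 * (v i * v i) := by
            refine sum_le_sum fun i _ => ?_
            have := mul_le_mul_of_nonneg_right (colMarg_div hp i) (mul_self_nonneg (v i))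
            refine le_trans (le_of_eq ?_) this
            unfold colMarg; ring
        _ = 2 := by rw [← mul_sum]; unfold dotProduct at hv; rw [hv]; norm_num
    linarith)
  rw [Fintype.sum_prod_type] at this
  refine le_trans (le_of_eq ?_) this
  refine sum_congr rfl fun i _ => sum_congr rfl fun j _ => ?_
  rw [mul_assoc]; congr 1
  simp

lemma Esample_mono {n m s : ℕ} {p : Matrix (Fin n) (Fin m) ℝ} (hp : IsDistrib p)
    {f g : (Fin s → Fin n × Fin m) → ℝ} (h : ∀ S, f S ≤ g S) : Esample s p f ≤ Esample s p g :=
  sum_le_sum fun S _ => mul_le_mul_of_nonneg_left (h S) (prod_nonneg fun t _ => hp.1 _ _)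

lemma distr_one {n m : ℕ} {p : Matrix (Fin n) (Fin m) ℝ} (hp : IsDistrib p) :
    ∑ z : Fin n × Fin m, p z.1 z.2 = 1 := by
  rw [Fintype.sum_prod_type]; exact hp.2

lemma Esample_const {n m s : ℕ} {p : Matrix (Fin n) (Fin m) ℝ} (hp : IsDistrib p) (c : ℝ) :
    Esample s p (fun _ => c) = c := by
  unfold Esample sampleProb
  rw [← sum_mul, E_one (fun z : Fin n × Fin m => p z.1 z.2) (distr_one hp), one_mul]

lemma Esample_emp {n m s : ℕ} (hs : 1 ≤ s) {p : Matrix (Fin n) (Fin m) ℝ} (hp : IsDistrib p)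
    (ℓ : ℝ → ℝ → ℝ) (Y X : Matrix (Fin n) (Fin m) ℝ) :
    Esample s p (fun S => empRisk ℓ Y S X) = popRisk p ℓ Y X := by
  unfold Esample sampleProb empRisk popRisk
  have := E_sum (s := s) (fun z : Fin n × Fin m => p z.1 z.2) (distr_one hp)
    (fun z => ℓ (X z.1 z.2) (Y z.1 z.2))
  rw [Fintype.sum_prod_type] at this
  simp only [mul_left_comm _ (1 / (s:ℝ)), ← mul_sum] at this ⊢
  rw [this]
  have : (s:ℝ) ≠ 0 := by positivity
  field_simp

lemma pop_diff {n m : ℕ} {p : Matrix (Fin n) (Fin m) ℝ} (hp : IsDistrib p) {r l : ℝ} (hl : 0 ≤ l)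
    {ℓ : ℝ → ℝ → ℝ} (hℓ : LipLoss l ℓ) {Y X X' : Matrix (Fin n) (Fin m) ℝ}
    (hX : X ∈ Wball (smoothR p) (smoothC p) r) (hX' : X' ∈ Wball (smoothR p) (smoothC p) r) :
    popRisk p ℓ Y X ≤ popRisk p ℓ Y X' + 4 * l * Real.sqrt r := by
  have h1 := ball_l1 hp hX
  have h2 := ball_l1 hp hX'
  have h3 : popRisk p ℓ Y X ≤ popRisk p ℓ Y X' +
      l * (∑ i, ∑ j, p i j * |X i j| + ∑ i, ∑ j, p i j * |X' i j|) := by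
    unfold popRisk
    simp only [← sum_add_distrib, mul_sum]
    refine sum_le_sum fun i _ => sum_le_sum fun j _ => ?_
    have a1 := (le_abs_self _).trans (hℓ (X i j) (X' i j) (Y i j))
    have a2 : l * |X i j - X' i j| ≤ l * (|X i j| + |X' i j|) := by
      gcongr; exact abs_sub _ _
    have a3 : ℓ (X i j) (Y i j) ≤ ℓ (X' i j) (Y i j) + l * (|X i j| + |X' i j|) := by linarith
    have := mul_le_mul_of_nonneg_left a3 (hp.1 i j)
    linarith
  have := mul_le_mul_of_nonneg_left (add_le_add h1 h2) hl
  linarith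

lemma mom_app {n m : ℕ} (s : ℕ) {p : Matrix (Fin n) (Fin m) ℝ} (hp : IsDistrib p) (hm : 2 ≤ m)
    (hmn : m ≤ n) : ∃ V : (Fin s → Fin n × Fin m) → ℝ, (∀ S, 0 < V S) ∧
      (∀ S i, ∑ t, (if (S t).1 = i then wt p (S t).1 (S t).2 ^ 2 else 0) ≤ V S) ∧
      (∀ S j, ∑ t, (if (S t).2 = j then wt p (S t).1 (S t).2 ^ 2 else 0) ≤ V S) ∧
      Esample s p V ≤ 4 * n ^ 2 * Real.log (n + m) + 8 * n * s := by
  have hn0 : (0:ℝ) < n := by exact_mod_cast (by omega : 0 < n)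
  have hm0 : (0:ℝ) < m := by exact_mod_cast (by omega : 0 < m)
  have hmn' : (m:ℝ) ≤ n := by exact_mod_cast hmn
  have hw : ∀ i j, wt p i j ^ 2 ≤ 4 * (n:ℝ) ^ 2 := by
    intro i j
    rw [wt_sq hp]
    calc _ ≤ (2 * (n:ℝ)) * (2 * m) := mul_le_mul (smoothR_inv hp i) (smoothC_inv hp j)
          (one_div_nonneg.2 (smoothC_pos hp j).le) (by positivity)
      _ ≤ (2 * (n:ℝ)) * (2 * n) := by gcongr
      _ = _ := by ring
  obtain ⟨V, hV0, hV, hE⟩ := moment (ι := Fin n ⊕ Fin m) s (fun z : Fin n × Fin m => p z.1 z.2)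
    (fun z => hp.1 _ _) (distr_one hp)
    (fun k z => Sum.elim (fun i => if z.1 = i then wt p z.1 z.2 ^ 2 else 0)
      (fun j => if z.2 = j then wt p z.1 z.2 ^ 2 else 0) k) (4 * (n:ℝ) ^ 2) (4 * n) (by positivity)
    (by
      rintro (i | j) z
      · simp only [Sum.elim_inl]; split_ifs <;> positivity
      · simp only [Sum.elim_inr]; split_ifs <;> positivity)
    (by
      rintro (i | j) z
      · simp only [Sum.elim_inl]; split_ifs
        · exact hw _ _
        · positivity
      · simp only [Sum.elim_inr]; split_ifs
        · exact hw _ _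
        · positivity)
    (by
      rintro (i | j)
      · simp only [Sum.elim_inl, mul_ite, mul_zero]
        rw [Fintype.sum_prod_type, sum_eq_single i (by intro b _ hb; simp [hb]) (by simp)]
        simp only [if_true, wt_sq hp]
        calc _ ≤ ∑ j, (p i j / smoothR p i) * (2 * m) := by
              refine sum_le_sum fun j _ => ?_
              rw [← mul_assoc, mul_one_div (p i j)]
              exact mul_le_mul_of_nonneg_left (smoothC_inv hp j)
                (div_nonneg (hp.1 i j) (smoothR_pos hp i).le)
          _ = rowMarg p i / smoothR p i * (2 * m) := by rw [← sum_mul, ← sum_div]; rfl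
          _ ≤ 2 * (2 * n) := mul_le_mul (rowMarg_div hp i) (by linarith) (by positivity) (by norm_num)
          _ = _ := by ring
      · simp only [Sum.elim_inr, mul_ite, mul_zero]
        rw [Fintype.sum_prod_type_right, sum_eq_single j (by intro b _ hb; simp [hb]) (by simp)]
        simp only [if_true, wt_sq hp]
        calc _ ≤ ∑ i, (p i j / smoothC p j) * (2 * n) := by
              refine sum_le_sum fun i _ => ?_
              rw [mul_comm (1 / smoothR p i), ← mul_assoc, mul_one_div (p i j)]
              exact mul_le_mul_of_nonneg_left (smoothR_inv hp i)
                (div_nonneg (hp.1 i j) (smoothC_pos hp j).le)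
          _ = colMarg p j / smoothC p j * (2 * n) := by rw [← sum_mul, ← sum_div]; rfl
          _ ≤ 2 * (2 * n) := mul_le_mul (colMarg_div hp j) (by linarith) (by positivity) (by norm_num)
          _ = _ := by ring)
    (by positivity)
    (by
      simp only [Fintype.card_sum, Fintype.card_fin, Nat.cast_add]
      rw [Real.lt_log_iff_exp_lt (by positivity)]
      have h1 := Real.exp_one_lt_d9
      have h2 : (2:ℝ) ≤ m := by exact_mod_cast hm
      linarith)
  refine ⟨V, hV0, fun S i => by simpa using hV S (Sum.inl i),
    fun S j => by simpa using hV S (Sum.inr j), ?_⟩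
  refine hE.trans (le_of_eq ?_)
  simp only [Fintype.card_sum, Fintype.card_fin, Nat.cast_add]
  ring

lemma large_s {n m s : ℕ} {r l : ℝ} {p : Matrix (Fin n) (Fin m) ℝ}
    {ℓ : ℝ → ℝ → ℝ} {Y : Matrix (Fin n) (Fin m) ℝ}
    {Xhat : (Fin s → Fin n × Fin m) → Matrix (Fin n) (Fin m) ℝ}
    (hm : 2 ≤ m) (hmn : m ≤ n) (hl : 0 ≤ l) (hp : IsDistrib p)
    (hℓ : LipLoss l ℓ) (hX : ∀ S, Xhat S ∈ Wball (smoothR p) (smoothC p) r)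
    (b : ℝ) (hb : 0 < b) (hbE : 4 * n ^ 2 * Real.log (n + m) + 8 * n * s ≤ b)
    (P : ℕ) (hP : 1 ≤ P) (hPd : ((n : ℝ) + m) ≤ Real.exp P) :
    s * Esample s p (fun S => popRisk p ℓ Y (Xhat S) - empRisk ℓ Y S (Xhat S)) ≤
      4 * l * (Real.sqrt r * Real.sqrt (4 * Real.exp 1 * P) * Real.sqrt b) := by
  have : NeZero n := ⟨by omega⟩
  have : NeZero m := ⟨by omega⟩
  have : Nonempty (Fin s → Fin n × Fin m) := ⟨fun _ => (0, 0)⟩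
  set q : Fin n × Fin m → ℝ := fun z => p z.1 z.2 with hq
  have hq0 : ∀ z, 0 ≤ q z := fun z => hp.1 _ _
  have hq1 : ∑ z, q z = 1 := distr_one hp
  set F : (Fin s → Fin n × Fin m) → Fin n × Fin m → ℝ :=
    fun k z => ℓ (Xhat k z.1 z.2) (Y z.1 z.2) with hF
  have hQ0 : ∀ S : Fin s → Fin n × Fin m, 0 ≤ ∏ t, q (S t) := fun S => prod_nonneg fun t _ => hq0 _
  have hQ1 : ∑ S : Fin s → Fin n × Fin m, ∏ t, q (S t) = 1 := E_one q hq1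
  obtain ⟨V, hV0, hV1, hV2, hVE⟩ := mom_app s hp hm hmn
  -- ghost sample
  have ghost : s * Esample s p (fun S => popRisk p ℓ Y (Xhat S) - empRisk ℓ Y S (Xhat S)) ≤
      ∑ S : Fin s → Fin n × Fin m, (∏ t, q (S t)) * ∑ S' : Fin s → Fin n × Fin m, (∏ t, q (S' t)) *
      (⨆ k, ∑ t, (F k (S' t) - F k (S t))) := by
    unfold Esample sampleProb
    rw [mul_sum]
    refine sum_le_sum fun S _ => ?_
    rw [mul_left_comm]
    refine mul_le_mul_of_nonneg_left ?_ (hQ0 S)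
    have h1 : (s:ℝ) * popRisk p ℓ Y (Xhat S) =
        ∑ S' : Fin s → Fin n × Fin m, (∏ t, q (S' t)) * ∑ t, F S (S' t) := by
      rw [E_sum q hq1, Fintype.sum_prod_type]; rfl
    have h2 : (s:ℝ) * empRisk ℓ Y S (Xhat S) = ∑ t, F S (S t) := by
      unfold empRisk
      rcases Nat.eq_zero_or_pos s with h | h
      · subst h; simp
      · have : (s:ℝ) ≠ 0 := by positivity
        rw [← mul_assoc, mul_one_div_cancel this, one_mul]
    rw [mul_sub, h1, h2]
    have h3 : ∑ t, F S (S t) = ∑ S' : Fin s → Fin n × Fin m, (∏ t, q (S' t)) * ∑ t, F S (S t) := by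
      rw [← sum_mul, hQ1, one_mul]
    rw [h3, ← sum_sub_distrib]
    refine sum_le_sum fun S' _ => ?_
    rw [← mul_sub, ← sum_sub_distrib]
    exact mul_le_mul_of_nonneg_left
      (le_ciSup (f := fun k => ∑ t, (F k (S' t) - F k (S t))) (Set.finite_range _).bddAbove S) (hQ0 S')
  have sym := symmetrization (s := s) q hq0 hq1 F
  have rad : ∀ S : Fin s → Fin n × Fin m, ∑ σ : Fin s → Bool, (⨆ k, ∑ t, sg (σ t) * F k (S t)) ≤
      2 ^ s * (2 * l * Real.sqrt r * Real.sqrt (4 * Real.exp 1 * P) * Real.sqrt (V S)) := by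
    intro S
    have c := contraction l s (fun _ : Fin s → Fin n × Fin m => 0) (fun t k => F k (S t))
      (fun t k => Xhat k (S t).1 (S t).2) (fun t k k' => hℓ _ _ _)
    simp only [zero_add] at c
    refine c.trans ?_
    obtain ⟨N, hN0, hN, hNs⟩ := rad_op S (wt p) (V S) (hV0 S) (hV1 S) (hV2 S) P hP hPd
    calc _ ≤ ∑ σ, l * (N σ * Real.sqrt r) := by
          refine sum_le_sum fun σ _ => ciSup_le fun k => ?_
          have := ball_dual hp (hX k) (fun t => sg (σ t)) S (N σ) (hN0 σ) (hN σ)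
          refine le_trans (le_of_eq ?_) (mul_le_mul_of_nonneg_left this hl)
          rw [mul_sum]
          exact sum_congr rfl fun t _ => by ring
      _ = l * Real.sqrt r * ∑ σ, N σ := by
          rw [mul_sum]; exact sum_congr rfl fun σ _ => by ring
      _ ≤ l * Real.sqrt r * (2 ^ s * (2 * Real.sqrt (4 * Real.exp 1 * P * V S))) := by
          gcongr
      _ = _ := by rw [Real.sqrt_mul (by positivity)]; ring
  have jen := sqrt_jensen (fun S : Fin s → Fin n × Fin m => ∏ t, q (S t)) V hQ0 hQ1
    (fun S => (hV0 S).le) b hb (hVE.trans hbE)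
  refine ghost.trans ?_
  have h2s : (0:ℝ) < 2 ^ s := by positivity
  refine le_of_mul_le_mul_left (sym.trans ?_) h2s
  calc _ ≤ 2 * ∑ S : Fin s → Fin n × Fin m, (∏ t, q (S t)) *
        (2 ^ s * (2 * l * Real.sqrt r * Real.sqrt (4 * Real.exp 1 * P) * Real.sqrt (V S))) := by
        gcongr with S _
        · exact hQ0 S
        · exact rad S
    _ = 2 ^ s * (4 * l * (Real.sqrt r * Real.sqrt (4 * Real.exp 1 * P) *
          ∑ S : Fin s → Fin n × Fin m, (∏ t, q (S t)) * Real.sqrt (V S))) := by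
        simp only [mul_sum]
        exact sum_congr rfl fun S _ => by ring
    _ ≤ _ := by gcongr

/-- Theorem 3: for an arbitrary sampling distribution `p`, any empirical
risk minimizer over the smoothed-weighted trace-norm ball `W_p̃` satisfies
`E_S[L_p(X̂_S)] ≤ inf_{X ∈ W_p̃} L_p(X) + C·l·√(r n log n / s)`. -/
theorem smoothed_weighted_traceNorm_arbitrary_distribution :
    ∃ C : ℝ, 0 < C ∧
      ∀ (n m s : ℕ) (r l : ℝ) (p : Matrix (Fin n) (Fin m) ℝ)
        (ℓ : ℝ → ℝ → ℝ) (Y : Matrix (Fin n) (Fin m) ℝ)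
        (Xhat : (Fin s → Fin n × Fin m) → Matrix (Fin n) (Fin m) ℝ),
        2 ≤ m → m ≤ n → 1 ≤ r → 0 ≤ l → 1 ≤ s →
        IsDistrib p →
        LipLoss l ℓ →
        (∀ S, Xhat S ∈ Wball (smoothR p) (smoothC p) r ∧
          ∀ X ∈ Wball (smoothR p) (smoothC p) r,
            empRisk ℓ Y S (Xhat S) ≤ empRisk ℓ Y S X) →
        Esample s p (fun S => popRisk p ℓ Y (Xhat S)) ≤
          sInf ((fun X => popRisk p ℓ Y X) '' Wball (smoothR p) (smoothC p) r) +
            C * l * Real.sqrt (r * n * Real.log n / s) := by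
  refine ⟨128, by norm_num, ?_⟩
  intro n m s r l p ℓ Y Xhat hm hmn hr hl hs hp hℓ hX
  have : NeZero n := ⟨by omega⟩
  have : NeZero m := ⟨by omega⟩
  have hS0 : Nonempty (Fin s → Fin n × Fin m) := ⟨fun _ => (0, 0)⟩
  have hn2 : (2:ℝ) ≤ n := by exact_mod_cast hm.trans hmn
  have hm2 : (2:ℝ) ≤ m := by exact_mod_cast hm
  have hmn' : (m:ℝ) ≤ n := by exact_mod_cast hmn
  have hs1 : (1:ℝ) ≤ s := by exact_mod_cast hs
  have hs0 : (0:ℝ) < s := by linarith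
  have hlog2 : (1/2:ℝ) ≤ Real.log n :=
    le_trans (by have := Real.log_two_gt_d9; linarith) (Real.log_le_log (by norm_num) hn2)
  rw [← sub_le_iff_le_add]
  refine le_csInf ⟨_, Xhat hS0.some, (hX _).1, rfl⟩ ?_
  rintro _ ⟨X, hXm, rfl⟩
  rw [sub_le_iff_le_add]
  simp only
  rcases le_total ((s:ℝ)) (n * Real.log n) with hcase | hcase
  · have h1 : Esample s p (fun S => popRisk p ℓ Y (Xhat S)) ≤
        popRisk p ℓ Y X + 4 * l * Real.sqrt r := by
      rw [← Esample_const (s := s) hp (popRisk p ℓ Y X + 4 * l * Real.sqrt r)]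
      exact Esample_mono hp fun S => pop_diff hp hl hℓ (hX S).1 hXm
    have h2 : Real.sqrt r ≤ Real.sqrt (r * n * Real.log n / s) := by
      apply Real.sqrt_le_sqrt
      rw [le_div_iff₀ hs0, mul_assoc]
      gcongr
    have h3 := mul_le_mul_of_nonneg_left h2 hl
    have h4 : 0 ≤ l * Real.sqrt (r * n * Real.log n / s) := by positivity
    linarith
  · have hlog : Real.log (n + m) ≤ 2 * Real.log n := by
      have : 2 * Real.log n = Real.log ((n:ℝ) ^ 2) := by rw [Real.log_pow]; norm_num
      rw [this]
      apply Real.log_le_log (by linarith)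
      nlinarith
    have hlogpos : 0 < Real.log (n + m) := Real.log_pos (by linarith)
    have hP1 : 1 ≤ ⌈Real.log (n + m)⌉₊ := Nat.one_le_ceil_iff.2 hlogpos
    have hPle : (⌈Real.log (n + m)⌉₊ : ℝ) ≤ 4 * Real.log n := by
      have := Nat.ceil_lt_add_one hlogpos.le
      linarith
    have hPd : ((n:ℝ) + m) ≤ Real.exp ⌈Real.log (n + m)⌉₊ := by
      rw [← Real.log_le_iff_le_exp (by linarith)]
      exact Nat.le_ceil _
    have hL := large_s (r := r) (Y := Y) hm hmn hl hp hℓ (fun S => (hX S).1) (16 * n * s) (by positivity) (by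
      have : (n:ℝ) * (n * Real.log n) ≤ n * s := by gcongr
      have h2 : 4 * (n:ℝ) ^ 2 * Real.log (n + m) ≤ 4 * (n:ℝ) ^ 2 * (2 * Real.log n) := by gcongr
      nlinarith) _ hP1 hPd
    generalize (⌈Real.log (n + m)⌉₊) = P at *
    have h1 : Esample s p (fun S => popRisk p ℓ Y (Xhat S)) ≤ popRisk p ℓ Y X +
        Esample s p (fun S => popRisk p ℓ Y (Xhat S) - empRisk ℓ Y S (Xhat S)) := by
      have a1 : Esample s p (fun S => empRisk ℓ Y S (Xhat S)) ≤ popRisk p ℓ Y X := by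
        rw [← Esample_emp hs hp ℓ Y X]
        exact Esample_mono hp fun S => (hX S).2 X hXm
      have a2 : Esample s p (fun S => popRisk p ℓ Y (Xhat S) - empRisk ℓ Y S (Xhat S)) =
          Esample s p (fun S => popRisk p ℓ Y (Xhat S)) -
            Esample s p (fun S => empRisk ℓ Y S (Xhat S)) := by
        unfold Esample; simp only [mul_sub, sum_sub_distrib]
      linarith
    have h2 : Real.sqrt r * Real.sqrt (4 * Real.exp 1 * P) * Real.sqrt (16 * n * s) ≤
        s * (32 * Real.sqrt (r * n * Real.log n / s)) := by
      have e1 : s * (32 * Real.sqrt (r * n * Real.log n / s)) =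
          Real.sqrt ((s * 32) ^ 2 * (r * n * Real.log n / s)) := by
        rw [Real.sqrt_mul (by positivity), Real.sqrt_sq (by positivity)]; ring
      rw [e1, ← Real.sqrt_mul (by positivity), ← Real.sqrt_mul (by positivity)]
      apply Real.sqrt_le_sqrt
      have he : Real.exp 1 ≤ 4 := by have := Real.exp_one_lt_d9; linarith
      calc r * (4 * Real.exp 1 * P) * (16 * n * s) ≤
            r * (4 * 4 * (4 * Real.log n)) * (16 * n * s) := by gcongr
        _ = _ := by field_simp; ring
    have h3 : Esample s p (fun S => popRisk p ℓ Y (Xhat S) - empRisk ℓ Y S (Xhat S)) ≤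
        128 * l * Real.sqrt (r * n * Real.log n / s) := by
      refine le_of_mul_le_mul_left (hL.trans ?_) hs0
      calc _ ≤ 4 * l * (s * (32 * Real.sqrt (r * n * Real.log n / s))) := by gcongr
        _ = _ := by ring
    linarith

end
end

section
/- Assume 24·n·log(n) ≤ s. Then, for a sample S of size s drawn i.i.d. from the distribution p on [n]×[m], with probability at least 1 − 2·n^{−2} the smoothed empirical marginals dominate half the smoothed true marginals: p̌^r(i) ≥ (1/2)·p̃^r(i) for all i ∈ [n] and p̌^c(j) ≥ (1/2)·p̃^c(j) for all j ∈ [m]. -/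
open scoped Classical
open Matrix Finset

noncomputable section

/-- Empirical row marginals of the sample `S`: `p̂^r(i) = #{t : i_t = i}/s`. -/
def empRowMarg {n m s : ℕ} (S : Fin s → Fin n × Fin m) (i : Fin n) : ℝ :=
  ((Finset.univ.filter fun t => (S t).1 = i).card : ℝ) / (s : ℝ)

/-- Empirical column marginals of the sample `S`: `p̂^c(j) = #{t : j_t = j}/s`. -/
def empColMarg {n m s : ℕ} (S : Fin s → Fin n × Fin m) (j : Fin m) : ℝ :=
  ((Finset.univ.filter fun t => (S t).2 = j).card : ℝ) / (s : ℝ)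

/-- Smoothed empirical row marginals: `p̌^r(i) = (p̂^r(i) + 1/n)/2`. -/
def checkR {n m s : ℕ} (S : Fin s → Fin n × Fin m) (i : Fin n) : ℝ :=
  (empRowMarg S i + 1 / (n : ℝ)) / 2

/-- Smoothed empirical column marginals: `p̌^c(j) = (p̂^c(j) + 1/m)/2`. -/
def checkC {n m s : ℕ} (S : Fin s → Fin n × Fin m) (j : Fin m) : ℝ :=
  (empColMarg S j + 1 / (m : ℝ)) / 2

theorem chernoff_aux {n m s : ℕ} (p : Matrix (Fin n) (Fin m) ℝ) (hp : IsDistrib p)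
    (A : Fin n × Fin m → Prop) [DecidablePred A] (q : ℝ)
    (hq : q = ∑ x : Fin n × Fin m, if A x then p x.1 x.2 else 0) :
    ∑ S : Fin s → Fin n × Fin m, sampleProb p S *
      (if ((Finset.univ.filter fun t => A (S t)).card : ℝ) < s * q / 2 then (1 : ℝ) else 0)
      ≤ Real.exp (-(s * q / 8)) := by
  have hq0 : 0 ≤ q := by
    rw [hq]
    refine Finset.sum_nonneg fun x _ => ?_
    split_ifs
    · exact hp.1 _ _
    · exact le_rfl
  have hsum : ∑ x : Fin n × Fin m, p x.1 x.2 = 1 := by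
    rw [Fintype.sum_prod_type]; exact hp.2
  have hmgf : ∑ x : Fin n × Fin m, p x.1 x.2 * (if A x then (1/2 : ℝ) else 1) = 1 - q / 2 := by
    have e : 1 - q / 2 = ∑ x : Fin n × Fin m,
        (p x.1 x.2 - (if A x then p x.1 x.2 else 0) / 2) := by
      rw [Finset.sum_sub_distrib, hsum, ← Finset.sum_div, ← hq]
    rw [e]
    refine Finset.sum_congr rfl fun x _ => ?_
    split_ifs <;> ring
  have hmgf0 : 0 ≤ 1 - q / 2 := by
    rw [← hmgf]
    refine Finset.sum_nonneg fun x _ => mul_nonneg (hp.1 _ _) ?_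
    split_ifs <;> norm_num
  have hpt : ∀ S : Fin s → Fin n × Fin m,
      sampleProb p S * (if ((Finset.univ.filter fun t => A (S t)).card : ℝ) < s * q / 2
        then (1 : ℝ) else 0) ≤
      Real.exp (Real.log 2 * (s * q / 2)) *
        ∏ t, (p (S t).1 (S t).2 * (if A (S t) then (1/2 : ℝ) else 1)) := by
    intro S
    have h0 : 0 ≤ sampleProb p S := Finset.prod_nonneg fun t _ => hp.1 _ _
    rw [Finset.prod_mul_distrib]
    change _ ≤ _ * (sampleProb p S * _)
    rw [mul_left_comm]
    refine mul_le_mul_of_nonneg_left ?_ h0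
    have hpr : ∏ t, (if A (S t) then (1/2 : ℝ) else 1)
        = Real.exp (- (Real.log 2 * ((Finset.univ.filter fun t => A (S t)).card : ℝ))) := by
      rw [← Finset.prod_filter, Finset.prod_const, Real.exp_neg, mul_comm, Real.exp_nat_mul,
        Real.exp_log (by norm_num)]
      simp
    rw [hpr, ← Real.exp_add]
    split_ifs with h
    · apply Real.one_le_exp
      have := Real.log_pos (one_lt_two : (1:ℝ) < 2)
      nlinarith
    · positivity
  refine (Finset.sum_le_sum fun S _ => hpt S).trans ?_
  rw [← Finset.mul_sum,
    ← Fintype.sum_pow (fun x : Fin n × Fin m => p x.1 x.2 * (if A x then (1/2 : ℝ) else 1)) s, hmgf]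
  have h1 : (1 - q / 2) ^ s ≤ Real.exp (-(s * q / 2)) := by
    calc (1 - q / 2) ^ s ≤ (Real.exp (-(q / 2))) ^ s :=
          pow_le_pow_left₀ hmgf0 (by linarith [Real.add_one_le_exp (-(q/2))]) _
      _ = _ := by rw [← Real.exp_nat_mul]; ring_nf
  refine (mul_le_mul_of_nonneg_left h1 (Real.exp_pos _).le).trans ?_
  rw [← Real.exp_add, Real.exp_le_exp]
  have h2 := Real.log_two_lt_d9
  have h3 : 0 ≤ (s : ℝ) * q := by positivity
  nlinarith

theorem bad_aux {n m s : ℕ} (p : Matrix (Fin n) (Fin m) ℝ) (hp : IsDistrib p)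
    (A : Fin n × Fin m → Prop) [DecidablePred A] (q : ℝ)
    (hq : q = ∑ x : Fin n × Fin m, if A x then p x.1 x.2 else 0)
    (k : ℕ) (hk : 2 ≤ k) (hkn : k ≤ n) (hs : 24 * (n : ℝ) * Real.log n ≤ (s : ℝ))
    (B : (Fin s → Fin n × Fin m) → Prop)
    (hB : ∀ S, ¬ B S → ¬ ((q / 2 + 1 / (2 * (k : ℝ))) / 2 ≤
      (((Finset.univ.filter fun t => A (S t)).card : ℝ) / (s : ℝ) + 1 / (k : ℝ)) / 2)) :
    ∑ S : Fin s → Fin n × Fin m, sampleProb p S * (if B S then (0 : ℝ) else 1)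
      ≤ 1 / (n : ℝ) ^ 3 := by
  have hn2 : (2 : ℝ) ≤ n := by exact_mod_cast hk.trans hkn
  have hk2 : (2 : ℝ) ≤ k := by exact_mod_cast hk
  have hkn' : (k : ℝ) ≤ n := by exact_mod_cast hkn
  have hn0 : (0 : ℝ) < n := by linarith
  have hk0 : (0 : ℝ) < k := by linarith
  have hlog : 0 < Real.log n := Real.log_pos (by linarith)
  have hs0 : (0 : ℝ) < s := lt_of_lt_of_le (by positivity) hs
  have hB' : ∀ S, ¬ B S →
      ((Finset.univ.filter fun t => A (S t)).card : ℝ) / (s : ℝ) < q / 2 - 1 / (2 * k) := by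
    intro S h
    have h := hB S h
    have e : 1 / (k : ℝ) = 2 * (1 / (2 * k)) := by field_simp
    rw [e] at h
    linarith
  have hsp : ∀ S : Fin s → Fin n × Fin m, 0 ≤ sampleProb p S :=
    fun S => Finset.prod_nonneg fun t _ => hp.1 _ _
  by_cases hqk : 1 / (k : ℝ) < q
  · have hqn : 1 / (n : ℝ) ≤ q := (one_div_le_one_div_of_le hk0 hkn').trans hqk.le
    have h1 : 1 ≤ q * n := by rwa [div_le_iff₀ hn0] at hqn
    have hq0 : 0 < q := lt_trans (by positivity) hqk
    refine le_trans (Finset.sum_le_sum fun S _ => mul_le_mul_of_nonneg_left ?_ (hsp S))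
      ((chernoff_aux p hp A q hq).trans ?_)
    · by_cases h : B S
      · rw [if_pos h]; split_ifs <;> norm_num
      · rw [if_neg h, if_pos]
        have h2 := hB' S h
        have h3 : ((Finset.univ.filter fun t => A (S t)).card : ℝ) / (s : ℝ) < q / 2 := by
          have : 0 < 1 / (2 * (k : ℝ)) := by positivity
          linarith
        rw [div_lt_iff₀ hs0] at h3
        linarith
    · have e : 1 / (n : ℝ) ^ 3 = Real.exp (-(3 * Real.log n)) := by
        rw [Real.exp_neg, show (3 : ℝ) * Real.log n = ((3 : ℕ) : ℝ) * Real.log n by norm_num,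
          Real.exp_nat_mul, Real.exp_log hn0, one_div]
      rw [e, Real.exp_le_exp]
      have h4 : 24 * (n : ℝ) * Real.log n * q ≤ s * q := mul_le_mul_of_nonneg_right hs hq0.le
      have h5 : Real.log n * 1 ≤ Real.log n * (q * n) := mul_le_mul_of_nonneg_left h1 hlog.le
      linarith
  · have : ∀ S, B S := by
      intro S
      by_contra h
      have h2 := hB' S h
      have h3 : (0 : ℝ) ≤ ((Finset.univ.filter fun t => A (S t)).card : ℝ) / (s : ℝ) := by
        positivity
      have e : 1 / (k : ℝ) = 2 * (1 / (2 * k)) := by field_simp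
      rw [e] at hqk
      linarith
    simp only [this, if_true, mul_zero, Finset.sum_const_zero]
    positivity

/-- Lemma 2: if `24·n·log n ≤ s` then, with probability at least
`1 − 2/n²` over an i.i.d. sample of size `s` from `p`, the smoothed empirical marginals
dominate half the smoothed true marginals. -/
theorem smoothed_empirical_marginals_dominate
    (n m s : ℕ) (p : Matrix (Fin n) (Fin m) ℝ)
    (hm : 2 ≤ m) (hnm : m ≤ n)
    (hp : IsDistrib p)
    (hs : 24 * (n : ℝ) * Real.log n ≤ (s : ℝ)) :
    1 - 2 / (n : ℝ) ^ 2 ≤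
      Esample s p (fun S =>
        if (∀ i, smoothR p i / 2 ≤ checkR S i) ∧ (∀ j, smoothC p j / 2 ≤ checkC S j)
        then (1 : ℝ) else 0) := by
  have hn2 : (2 : ℝ) ≤ n := by exact_mod_cast hm.trans hnm
  have hmn' : (m : ℝ) ≤ n := by exact_mod_cast hnm
  have hn0 : (0 : ℝ) < n := by linarith
  have hrow : ∀ i : Fin n, ∑ S : Fin s → Fin n × Fin m, sampleProb p S *
      (if smoothR p i / 2 ≤ checkR S i then (0 : ℝ) else 1) ≤ 1 / (n : ℝ) ^ 3 := by
    intro i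
    refine bad_aux p hp (fun x => x.1 = i) (rowMarg p i) ?_ n (hm.trans hnm) le_rfl hs
      (fun S => smoothR p i / 2 ≤ checkR S i) ?_
    · rw [Fintype.sum_prod_type, Finset.sum_eq_single i]
      · simp [rowMarg]
      · intro b _ hb; simp [hb]
      · simp
    · intro S h
      exact h
  have hcol : ∀ j : Fin m, ∑ S : Fin s → Fin n × Fin m, sampleProb p S *
      (if smoothC p j / 2 ≤ checkC S j then (0 : ℝ) else 1) ≤ 1 / (n : ℝ) ^ 3 := by
    intro j
    refine bad_aux p hp (fun x => x.2 = j) (colMarg p j) ?_ m hm hnm hs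
      (fun S => smoothC p j / 2 ≤ checkC S j) ?_
    · rw [Fintype.sum_prod_type]
      simp [colMarg]
    · intro S h
      exact h
  have hone : ∑ S : Fin s → Fin n × Fin m, sampleProb p S = 1 := by
    unfold sampleProb
    rw [← Fintype.sum_pow (fun x : Fin n × Fin m => p x.1 x.2) s, Fintype.sum_prod_type]
    simp only
    rw [hp.2, one_pow]
  have hsp : ∀ S : Fin s → Fin n × Fin m, 0 ≤ sampleProb p S :=
    fun S => Finset.prod_nonneg fun t _ => hp.1 _ _
  have hnnR : ∀ S : Fin s → Fin n × Fin m, ∀ i ∈ (Finset.univ : Finset (Fin n)),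
      (0 : ℝ) ≤ (if smoothR p i / 2 ≤ checkR S i then (0 : ℝ) else 1) := by
    intro S i _; split_ifs <;> norm_num
  have hnnC : ∀ S : Fin s → Fin n × Fin m, ∀ j ∈ (Finset.univ : Finset (Fin m)),
      (0 : ℝ) ≤ (if smoothC p j / 2 ≤ checkC S j then (0 : ℝ) else 1) := by
    intro S j _; split_ifs <;> norm_num
  have key : ∀ S : Fin s → Fin n × Fin m,
      sampleProb p S ≤ sampleProb p S *
        (if (∀ i, smoothR p i / 2 ≤ checkR S i) ∧ (∀ j, smoothC p j / 2 ≤ checkC S j)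
        then (1 : ℝ) else 0)
      + (∑ i, sampleProb p S * (if smoothR p i / 2 ≤ checkR S i then (0 : ℝ) else 1)
      + ∑ j, sampleProb p S * (if smoothC p j / 2 ≤ checkC S j then (0 : ℝ) else 1)) := by
    intro S
    rw [← Finset.mul_sum, ← Finset.mul_sum, ← mul_add, ← mul_add]
    refine le_mul_of_one_le_right (hsp S) ?_
    have hR := Finset.sum_nonneg (hnnR S)
    have hC := Finset.sum_nonneg (hnnC S)
    by_cases h : (∀ i, smoothR p i / 2 ≤ checkR S i) ∧ (∀ j, smoothC p j / 2 ≤ checkC S j)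
    · rw [if_pos h]; linarith
    · rw [if_neg h]
      rw [not_and_or, not_forall, not_forall] at h
      rcases h with ⟨i, hi⟩ | ⟨j, hj⟩
      · have := Finset.single_le_sum (hnnR S) (Finset.mem_univ i)
        rw [if_neg hi] at this
        linarith
      · have := Finset.single_le_sum (hnnC S) (Finset.mem_univ j)
        rw [if_neg hj] at this
        linarith
  have hfin := Finset.sum_le_sum fun S (_ : S ∈ Finset.univ) => key S
  rw [hone, Finset.sum_add_distrib, Finset.sum_add_distrib, Finset.sum_comm (t := (Finset.univ : Finset (Fin n))),
    Finset.sum_comm (t := (Finset.univ : Finset (Fin m)))] at hfin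
  have h1 := Finset.sum_le_sum fun i (_ : i ∈ Finset.univ) => hrow i
  have h2 := Finset.sum_le_sum fun j (_ : j ∈ Finset.univ) => hcol j
  rw [Finset.sum_const, Finset.card_univ, Fintype.card_fin, nsmul_eq_mul] at h1 h2
  have h3 : (m : ℝ) * (1 / (n : ℝ) ^ 3) ≤ n * (1 / (n : ℝ) ^ 3) :=
    mul_le_mul_of_nonneg_right hmn' (by positivity)
  have h4 : 2 / (n : ℝ) ^ 2 = n * (1 / (n : ℝ) ^ 3) + n * (1 / (n : ℝ) ^ 3) := by
    field_simp; norm_num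
  unfold Esample
  rw [h4]
  linarith

end
end

section
/- Fix a matrix X* ∈ ℝ^{n×m} with ‖X*‖_tr(p̃)² = r* ≤ r, and for a sample S define c(S) = max{0, ‖X*/√r*‖_tr(p̌) − 1}, where p̌ are the smoothed empirical marginals of S. Then, in expectation over a sample S of size s drawn i.i.d. from p, E_S[L_p((1 − c(S))·X*) − L_p(X*)] ≤ √(2·l²·r·n/s). -/
open scoped Classical
open Matrix Finset

noncomputable section

lemma traceNorm_data {n m : ℕ} (A : Matrix (Fin n) (Fin m) ℝ) :
    ∃ (V : Matrix (Fin m) (Fin m) ℝ) (lam : Fin m → ℝ), Vᵀ * V = 1 ∧ V * Vᵀ = 1 ∧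
      (∀ k, 0 ≤ lam k) ∧ (A * V)ᵀ * (A * V) = Matrix.diagonal lam ∧
      traceNorm A = ∑ k, Real.sqrt (lam k) := by
  have hA := Matrix.isHermitian_conjTranspose_mul_self A
  have h1 : (hA.eigenvectorUnitary : Matrix (Fin m) (Fin m) ℝ)ᵀ * hA.eigenvectorUnitary = 1 := by
    have := (Matrix.mem_unitaryGroup_iff' (A := (hA.eigenvectorUnitary : Matrix (Fin m) (Fin m) ℝ))).1
      hA.eigenvectorUnitary.2
    simpa [Matrix.star_eq_conjTranspose] using this
  refine ⟨hA.eigenvectorUnitary, hA.eigenvalues, h1, mul_eq_one_comm.1 h1, ?_, ?_, rfl⟩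
  · intro k
    exact (Matrix.posSemidef_conjTranspose_mul_self A).eigenvalues_nonneg k
  · have h2 := hA.spectral_theorem
    rw [Unitary.conjStarAlgAut_apply] at h2
    generalize hA.eigenvalues = lam at h2
    generalize (hA.eigenvectorUnitary : Matrix (Fin m) (Fin m) ℝ) = V at h1 h2
    have h3 : Aᵀ * A = V * Matrix.diagonal lam * Vᵀ := by
      simpa [Matrix.star_eq_conjTranspose, Function.comp_def] using h2
    calc (A * V)ᵀ * (A * V) = Vᵀ * (Aᵀ * A) * V := by
          rw [Matrix.transpose_mul]; simp only [Matrix.mul_assoc]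
      _ = (Vᵀ * V) * Matrix.diagonal lam * (Vᵀ * V) := by
          rw [h3]; simp only [Matrix.mul_assoc]
      _ = _ := by rw [h1]; simp

lemma colsq {n m : ℕ} {B : Matrix (Fin n) (Fin m) ℝ} {lam : Fin m → ℝ}
    (h : Bᵀ * B = Matrix.diagonal lam) (k : Fin m) : ∑ i, B i k ^ 2 = lam k := by
  have := congrFun (congrFun h k) k
  simp [Matrix.mul_apply] at this
  rw [← this]
  exact Finset.sum_congr rfl fun i _ => by ring

/-- Factorization realizing the trace norm. -/
lemma traceNorm_factor {n m : ℕ} (A : Matrix (Fin n) (Fin m) ℝ) :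
    ∃ (P : Matrix (Fin n) (Fin m) ℝ) (Q : Matrix (Fin m) (Fin m) ℝ),
      (∀ i j, A i j = ∑ k, P i k * Q j k) ∧
      ∑ i, ∑ k, P i k ^ 2 = traceNorm A ∧ ∑ j, ∑ k, Q j k ^ 2 = traceNorm A := by
  obtain ⟨V, lam, hV, hV', hlam, hAV, htr⟩ := traceNorm_data A
  have hc := colsq hAV
  have hsq : ∀ k, Real.sqrt (Real.sqrt (lam k)) ^ 2 = Real.sqrt (lam k) := fun k =>
    Real.sq_sqrt (Real.sqrt_nonneg _)
  have hsq2 : ∀ k, Real.sqrt (lam k) ^ 2 = lam k := fun k => Real.sq_sqrt (hlam k)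
  refine ⟨fun i k => (A * V) i k * (Real.sqrt (Real.sqrt (lam k)))⁻¹,
    fun j k => V j k * Real.sqrt (Real.sqrt (lam k)), ?_, ?_, ?_⟩
  · intro i j
    have h1 : A i j = (A * V * Vᵀ) i j := by rw [Matrix.mul_assoc, hV']; simp
    rw [h1, Matrix.mul_apply]
    refine Finset.sum_congr rfl fun k _ => ?_
    rw [Matrix.transpose_apply]
    by_cases hk : lam k = 0
    · have h0 : (A * V) i k = 0 := by
        have := hc k
        rw [hk, Finset.sum_eq_zero_iff_of_nonneg (fun _ _ => sq_nonneg _)] at this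
        simpa using this i (Finset.mem_univ _)
      rw [h0]; simp [hk]
    · have : Real.sqrt (Real.sqrt (lam k)) ≠ 0 := by
        have : 0 < lam k := lt_of_le_of_ne (hlam k) (Ne.symm hk)
        positivity
      field_simp
  · rw [Finset.sum_comm, htr]
    refine Finset.sum_congr rfl fun k _ => ?_
    simp only [mul_pow]
    rw [← Finset.sum_mul, hc, inv_pow, hsq]
    by_cases hk : lam k = 0
    · simp [hk]
    · have : 0 < Real.sqrt (lam k) := by
        have : 0 < lam k := lt_of_le_of_ne (hlam k) (Ne.symm hk)
        positivity
      field_simp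
      exact (hsq2 k).symm
  · rw [Finset.sum_comm, htr]
    refine Finset.sum_congr rfl fun k _ => ?_
    simp only [mul_pow]
    have h1 : Vᵀ * V = Matrix.diagonal (fun _ => (1:ℝ)) := by rw [hV]; simp
    rw [← Finset.sum_mul, colsq h1, hsq, one_mul]

lemma trace_sq {a b : ℕ} (B : Matrix (Fin a) (Fin b) ℝ) :
    (Bᵀ * B).trace = ∑ i, ∑ k, B i k ^ 2 := by
  rw [Finset.sum_comm]
  simp [Matrix.trace, Matrix.mul_apply, pow_two]

lemma trace_cs {a b : ℕ} (B C : Matrix (Fin a) (Fin b) ℝ) :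
    (Bᵀ * C).trace ≤ ((Bᵀ * B).trace + (Cᵀ * C).trace) / 2 := by
  rw [trace_sq, trace_sq, Finset.sum_comm, Finset.sum_comm (f := fun i k => C i k ^ 2),
    ← Finset.sum_add_distrib, Finset.sum_div]
  simp only [Matrix.trace, Matrix.diag, Matrix.mul_apply, Matrix.transpose_apply]
  refine Finset.sum_le_sum fun k _ => ?_
  rw [← Finset.sum_add_distrib, Finset.sum_div]
  refine Finset.sum_le_sum fun i _ => ?_
  nlinarith [sq_nonneg (B i k - C i k)]

lemma traceNorm_mul_le {n m d : ℕ} (P : Matrix (Fin n) (Fin d) ℝ) (Q : Matrix (Fin m) (Fin d) ℝ) :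
    traceNorm (P * Qᵀ) ≤ (∑ i, ∑ k, P i k ^ 2 + ∑ j, ∑ k, Q j k ^ 2) / 2 := by
  obtain ⟨V, lam, hV, hV', hlam, hAV, htr⟩ := traceNorm_data (P * Qᵀ)
  set D : Matrix (Fin m) (Fin m) ℝ := Matrix.diagonal (fun k => (Real.sqrt (lam k))⁻¹) with hD
  set U := P * Qᵀ * V * D with hU
  have hDt : Dᵀ = D := by simp [hD]
  have hUU : Uᵀ * (P * Qᵀ * V) = Matrix.diagonal (fun k => Real.sqrt (lam k)) := by
    rw [hU, Matrix.transpose_mul, Matrix.mul_assoc, hAV, hDt, hD, Matrix.diagonal_mul_diagonal]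
    congr 1; ext k
    by_cases hk : Real.sqrt (lam k) = 0
    · simp [hk]
    · field_simp; exact (Real.sq_sqrt (hlam k)).symm
  have hproj : U * (Uᵀ * U) = U := by
    have : Uᵀ * U = Matrix.diagonal (fun k => Real.sqrt (lam k)) * D := by
      rw [← hUU, hU]; simp only [Matrix.mul_assoc]
    rw [this, hU, Matrix.mul_assoc (P * Qᵀ * V) D, hD, Matrix.diagonal_mul_diagonal,
      Matrix.diagonal_mul_diagonal]
    congr 2; ext k
    by_cases hk : Real.sqrt (lam k) = 0
    · simp [hk]
    · field_simp
  have hproj' : Uᵀ * U * Uᵀ = Uᵀ := by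
    have := congrArg Matrix.transpose hproj
    simpa [Matrix.transpose_mul, Matrix.mul_assoc] using this
  have e1 : traceNorm (P * Qᵀ) = ((Pᵀ * U)ᵀ * (Qᵀ * V)).trace := by
    have : (Pᵀ * U)ᵀ * (Qᵀ * V) = Uᵀ * (P * Qᵀ * V) := by
      simp [Matrix.transpose_mul, Matrix.mul_assoc]
    rw [this, hUU, htr, Matrix.trace_diagonal]
  have e2 : ((Qᵀ * V)ᵀ * (Qᵀ * V)).trace = ∑ j, ∑ k, Q j k ^ 2 := by
    rw [Matrix.trace_mul_comm, ← trace_sq]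
    congr 1
    rw [Matrix.transpose_mul, Matrix.transpose_transpose, Matrix.mul_assoc, ← Matrix.mul_assoc V,
      hV', Matrix.one_mul]
  have e3 : ((Pᵀ * U)ᵀ * (Pᵀ * U)).trace ≤ ∑ i, ∑ k, P i k ^ 2 := by
    have h0 : 0 ≤ ((P - U * (Uᵀ * P))ᵀ * (P - U * (Uᵀ * P))).trace := by
      rw [trace_sq]; positivity
    have h1 : (P - U * (Uᵀ * P))ᵀ * (P - U * (Uᵀ * P)) = Pᵀ * P - Pᵀ * U * (Uᵀ * P) := by
      have h2 : Uᵀ * (U * (Uᵀ * P)) = Uᵀ * P := by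
        rw [← Matrix.mul_assoc, ← Matrix.mul_assoc, hproj']
      simp only [Matrix.transpose_sub, Matrix.transpose_mul, Matrix.transpose_transpose,
        Matrix.sub_mul, Matrix.mul_sub, Matrix.mul_assoc, h2]
      abel
    rw [h1, Matrix.trace_sub, trace_sq] at h0
    rw [Matrix.trace_mul_comm, Matrix.transpose_mul, Matrix.transpose_transpose]
    linarith
  have := trace_cs (Pᵀ * U) (Qᵀ * V)
  rw [e1]; linarith

lemma wTrNorm_le {n m d : ℕ} (qr : Fin n → ℝ) (qc : Fin m → ℝ) (hqr : ∀ i, 0 ≤ qr i)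
    (hqc : ∀ j, 0 ≤ qc j) (W : Matrix (Fin n) (Fin m) ℝ)
    (U : Matrix (Fin n) (Fin d) ℝ) (V : Matrix (Fin m) (Fin d) ℝ)
    (hW : ∀ i j, W i j = ∑ k, U i k * V j k) :
    wTrNorm qr qc W ≤ (∑ i, qr i * ∑ k, U i k ^ 2 + ∑ j, qc j * ∑ k, V j k ^ 2) / 2 := by
  have hWm : W = U * Vᵀ := by ext i j; rw [hW]; rfl
  have h := traceNorm_mul_le (Matrix.diagonal (fun i => Real.sqrt (qr i)) * U)
    (Matrix.diagonal (fun i => Real.sqrt (qc i)) * V)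
  unfold wTrNorm
  rw [hWm]
  rw [Matrix.transpose_mul, Matrix.diagonal_transpose] at h
  simp only [Matrix.diagonal_mul, mul_pow, Real.sq_sqrt (hqr _), Real.sq_sqrt (hqc _),
    ← Finset.mul_sum] at h
  simpa only [Matrix.mul_assoc] using h

lemma wTrNorm_factor {n m : ℕ} (qr : Fin n → ℝ) (qc : Fin m → ℝ) (hqr : ∀ i, 0 < qr i)
    (hqc : ∀ j, 0 < qc j) (X : Matrix (Fin n) (Fin m) ℝ) (rho : ℝ) (hrho : 0 < rho)
    (h : wTrNorm qr qc X = rho) :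
    ∃ (U : Matrix (Fin n) (Fin m) ℝ) (V : Matrix (Fin m) (Fin m) ℝ),
      (∀ i j, X i j = rho * ∑ k, U i k * V j k) ∧
      ∑ i, qr i * ∑ k, U i k ^ 2 = 1 ∧ ∑ j, qc j * ∑ k, V j k ^ 2 = 1 := by
  obtain ⟨P, Q, hPQ, hP, hQ⟩ := traceNorm_factor (Matrix.diagonal (fun i => Real.sqrt (qr i)) * X *
    Matrix.diagonal (fun j => Real.sqrt (qc j)))
  change _ = wTrNorm qr qc X at hP hQ
  rw [h] at hP hQ
  have hsr : 0 < Real.sqrt rho := Real.sqrt_pos.2 hrho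
  refine ⟨fun i k => P i k / (Real.sqrt (qr i) * Real.sqrt rho),
    fun j k => Q j k / (Real.sqrt (qc j) * Real.sqrt rho), ?_, ?_, ?_⟩
  · intro i j
    have h1 := hPQ i j
    rw [Matrix.mul_diagonal, Matrix.diagonal_mul] at h1
    have hi := Real.sqrt_pos.2 (hqr i)
    have hj := Real.sqrt_pos.2 (hqc j)
    have : ∀ k, P i k / (Real.sqrt (qr i) * Real.sqrt rho) * (Q j k / (Real.sqrt (qc j) * Real.sqrt rho))
        = P i k * Q j k * (1 / (Real.sqrt (qr i) * Real.sqrt (qc j) * rho)) := by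
      intro k
      rw [div_mul_div_comm, mul_one_div]
      congr 1
      rw [mul_mul_mul_comm, Real.mul_self_sqrt hrho.le]
    simp only [this]
    rw [← Finset.sum_mul, ← h1]
    field_simp
  · have : ∀ i, qr i * ∑ k, (P i k / (Real.sqrt (qr i) * Real.sqrt rho)) ^ 2 = (∑ k, P i k ^ 2) / rho := by
      intro i
      simp only [div_pow, mul_pow, Real.sq_sqrt (hqr i).le, Real.sq_sqrt hrho.le]
      rw [← Finset.sum_div]
      have := hqr i
      field_simp
    simp only [this]
    rw [← Finset.sum_div, hP, div_self hrho.ne']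
  · have : ∀ i, qc i * ∑ k, (Q i k / (Real.sqrt (qc i) * Real.sqrt rho)) ^ 2 = (∑ k, Q i k ^ 2) / rho := by
      intro i
      simp only [div_pow, mul_pow, Real.sq_sqrt (hqc i).le, Real.sq_sqrt hrho.le]
      rw [← Finset.sum_div]
      have := hqc i
      field_simp
    simp only [this]
    rw [← Finset.sum_div, hQ, div_self hrho.ne']

lemma iid_sum_succ {α : Type*} [Fintype α] (s : ℕ) (F : (Fin (s+1) → α) → ℝ) :
    ∑ S, F S = ∑ a, ∑ S : Fin s → α, F (Fin.cons a S) := by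
  rw [← (Fin.consEquiv (fun _ : Fin (s+1) => α)).sum_comp, Fintype.sum_prod_type]
  rfl

lemma iid_moments {α : Type*} [Fintype α] (w g : α → ℝ) (hw : ∑ a, w a = 1)
    (hg : ∑ a, w a * g a = 0) (s : ℕ) :
    (∑ S : Fin s → α, ∏ t, w (S t) = 1) ∧
    (∑ S : Fin s → α, (∏ t, w (S t)) * ∑ t, g (S t) = 0) ∧
    (∑ S : Fin s → α, (∏ t, w (S t)) * (∑ t, g (S t)) ^ 2 = s * ∑ a, w a * g a ^ 2) := by
  induction s with
  | zero => simp
  | succ s ih =>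
    obtain ⟨i1, i2, i3⟩ := ih
    simp only [iid_sum_succ, Fin.prod_univ_succ, Fin.sum_univ_succ, Fin.cons_zero, Fin.cons_succ]
    refine ⟨?_, ?_, ?_⟩
    · simp only [← Finset.mul_sum, i1, mul_one, hw]
    · have : ∀ a, ∑ S : Fin s → α, w a * (∏ t, w (S t)) * (g a + ∑ t, g (S t)) = w a * g a := by
        intro a
        calc _ = w a * g a * (∑ S : Fin s → α, ∏ t, w (S t)) +
              w a * ∑ S : Fin s → α, (∏ t, w (S t)) * ∑ t, g (S t) := by
              rw [Finset.mul_sum, Finset.mul_sum, ← Finset.sum_add_distrib]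
              exact Finset.sum_congr rfl fun _ _ => by ring
          _ = _ := by rw [i1, i2]; ring
      simp only [this, hg]
    · have : ∀ a, ∑ S : Fin s → α, w a * (∏ t, w (S t)) * (g a + ∑ t, g (S t)) ^ 2
          = w a * g a ^ 2 + w a * (s * ∑ a, w a * g a ^ 2) := by
        intro a
        calc _ = w a * g a ^ 2 * (∑ S : Fin s → α, ∏ t, w (S t)) +
              2 * w a * g a * (∑ S : Fin s → α, (∏ t, w (S t)) * ∑ t, g (S t)) +
              w a * ∑ S : Fin s → α, (∏ t, w (S t)) * (∑ t, g (S t)) ^ 2 := by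
              rw [Finset.mul_sum, Finset.mul_sum, Finset.mul_sum, ← Finset.sum_add_distrib,
                ← Finset.sum_add_distrib]
              exact Finset.sum_congr rfl fun _ _ => by ring
          _ = _ := by rw [i1, i2, i3]; ring
      simp only [this]
      rw [Finset.sum_add_distrib, ← Finset.sum_mul, hw]
      push_cast; ring

lemma iid_pos_part {α : Type*} [Fintype α] (w g : α → ℝ) (hw0 : ∀ a, 0 ≤ w a) (hw : ∑ a, w a = 1)
    (hg : ∑ a, w a * g a = 0) (s : ℕ) (hs : 1 ≤ s) (B : ℝ) (hB : 0 < B)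
    (hgB : ∑ a, w a * g a ^ 2 ≤ 16 * B)
    (c : (Fin s → α) → ℝ) (hc : ∀ S, c S ≤ max 0 (1 / (4 * s) * ∑ t, g (S t))) :
    ∑ S : Fin s → α, (∏ t, w (S t)) * c S ≤ Real.sqrt (B / s) / 2 := by
  obtain ⟨h1, h2, h3⟩ := iid_moments w g hw hg s
  have hs' : (0:ℝ) < s := by exact_mod_cast hs
  have hBs : 0 < B / s := by positivity
  set a := Real.sqrt (B / s) with ha
  have hapos : 0 < a := Real.sqrt_pos.2 hBs
  have ha2 : a ^ 2 = B / s := Real.sq_sqrt hBs.le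
  set k : ℝ := 1 / (4 * s) with hk
  have hpt : ∀ S : Fin s → α, (∏ t, w (S t)) * c S ≤
      (k / 2) * ((∏ t, w (S t)) * ∑ t, g (S t)) +
      (k ^ 2 / (4 * a)) * ((∏ t, w (S t)) * (∑ t, g (S t)) ^ 2) + (a / 4) * ∏ t, w (S t) := by
    intro S
    have hp : 0 ≤ ∏ t, w (S t) := Finset.prod_nonneg fun _ _ => hw0 _
    have : c S ≤ k / 2 * ∑ t, g (S t) + k ^ 2 / (4 * a) * (∑ t, g (S t)) ^ 2 + a / 4 := by
      refine (hc S).trans ?_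
      generalize (∑ t, g (S t)) = x
      have e : k / 2 * x + k ^ 2 / (4 * a) * x ^ 2 + a / 4 = (k * x + a) ^ 2 / (4 * a) := by
        field_simp; ring
      have e' : (k * x + a) ^ 2 / (4 * a) = k * x + (k * x - a) ^ 2 / (4 * a) := by
        field_simp; ring
      refine max_le ?_ ?_
      · rw [e]; positivity
      · rw [e, e']
        have : 0 ≤ (k * x - a) ^ 2 / (4 * a) := by positivity
        linarith
    calc _ ≤ _ := mul_le_mul_of_nonneg_left this hp
      _ = _ := by ring
  refine (Finset.sum_le_sum fun S _ => hpt S).trans ?_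
  rw [Finset.sum_add_distrib, Finset.sum_add_distrib, ← Finset.mul_sum, ← Finset.mul_sum,
    ← Finset.mul_sum, h1, h2, h3]
  have : k ^ 2 / (4 * a) * (s * ∑ a, w a * g a ^ 2) ≤ k ^ 2 / (4 * a) * (s * (16 * B)) := by
    gcongr
  have e : k ^ 2 / (4 * a) * (s * (16 * B)) = a / 4 := by
    have : B = a ^ 2 * s := by rw [ha2]; field_simp
    rw [this, hk]; field_simp; try norm_num
  linarith

lemma sum_empRow {n m s : ℕ} (S : Fin s → Fin n × Fin m) (u : Fin n → ℝ) :
    ∑ i, empRowMarg S i * u i = (1 / s) * ∑ t, u (S t).1 := by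
  unfold empRowMarg
  simp only [Finset.card_filter, Nat.cast_sum, Nat.cast_ite, Nat.cast_one, Nat.cast_zero,
    Finset.sum_div, Finset.sum_mul]
  rw [Finset.sum_comm, Finset.mul_sum]
  refine Finset.sum_congr rfl fun t _ => ?_
  rw [Finset.sum_eq_single (S t).1]
  · simp
  · intro b _ hb; simp [Ne.symm hb]
  · simp

lemma sum_empCol {n m s : ℕ} (S : Fin s → Fin n × Fin m) (u : Fin m → ℝ) :
    ∑ i, empColMarg S i * u i = (1 / s) * ∑ t, u (S t).2 := by
  unfold empColMarg
  simp only [Finset.card_filter, Nat.cast_sum, Nat.cast_ite, Nat.cast_one, Nat.cast_zero,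
    Finset.sum_div, Finset.sum_mul]
  rw [Finset.sum_comm, Finset.mul_sum]
  refine Finset.sum_congr rfl fun t _ => ?_
  rw [Finset.sum_eq_single (S t).2]
  · simp
  · intro b _ hb; simp [Ne.symm hb]
  · simp

/-- Lemma 3: fix `X*` with `‖X*‖²_tr(p̃) = r* ≤ r` and let
`c(S) = max{0, ‖X*/√r*‖_tr(p̌) − 1}`. Then
`E_S[L_p((1 − c(S))·X*) − L_p(X*)] ≤ √(2 l² r n / s)`. -/
theorem shrinkage_excess_risk_bound
    (n m s : ℕ) (r rstar l : ℝ) (p : Matrix (Fin n) (Fin m) ℝ)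
    (ℓ : ℝ → ℝ → ℝ) (Y : Matrix (Fin n) (Fin m) ℝ)
    (Xstar : Matrix (Fin n) (Fin m) ℝ)
    (hm : 2 ≤ m) (hnm : m ≤ n) (hr : 1 ≤ r) (hl : 0 ≤ l) (hs : 1 ≤ s)
    (hp : IsDistrib p) (hL : LipLoss l ℓ)
    (hXstar : (wTrNorm (smoothR p) (smoothC p) Xstar) ^ 2 = rstar)
    (hrstar : rstar ≤ r) :
    Esample s p (fun S =>
        popRisk p ℓ Y
          ((1 - max 0
            (wTrNorm (checkR S) (checkC S) ((Real.sqrt rstar)⁻¹ • Xstar) - 1)) • Xstar) -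
        popRisk p ℓ Y Xstar) ≤
      Real.sqrt (2 * l ^ 2 * r * n / s) := by
  obtain ⟨hp0, hp1⟩ := hp
  have hs' : (0:ℝ) < s := by exact_mod_cast hs
  have hm' : (0:ℝ) < m := by exact_mod_cast (by omega : 0 < m)
  have hn' : (0:ℝ) < n := by exact_mod_cast (by omega : 0 < n)
  have hmn : (m:ℝ) ≤ n := by exact_mod_cast hnm
  have hrow0 : ∀ i, 0 ≤ rowMarg p i := fun i => Finset.sum_nonneg fun j _ => hp0 i j
  have hcol0 : ∀ j, 0 ≤ colMarg p j := fun j => Finset.sum_nonneg fun i _ => hp0 i j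
  have hsR : ∀ i, 0 < smoothR p i := fun i => by
    have := hrow0 i
    unfold smoothR; positivity
  have hsC : ∀ i, 0 < smoothC p i := fun i => by
    have := hcol0 i
    unfold smoothC; positivity
  have hT0 : 0 ≤ wTrNorm (smoothR p) (smoothC p) Xstar := by
    unfold wTrNorm traceNorm
    exact Finset.sum_nonneg fun _ _ => Real.sqrt_nonneg _
  set rho := wTrNorm (smoothR p) (smoothC p) Xstar with hrho
  have hsq : Real.sqrt rstar = rho := by rw [← hXstar, Real.sqrt_sq hT0]
  rw [hsq]
  rcases hT0.eq_or_lt with h0 | hpos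
  · -- degenerate case
    rw [← h0]
    have hz : ∀ (qr : Fin n → ℝ) (qc : Fin m → ℝ),
        wTrNorm qr qc (((0:ℝ)⁻¹) • Xstar) ≤ 0 := by
      intro qr qc
      have := traceNorm_mul_le (n := n) (m := m) (d := 0) 0 0
      simpa [wTrNorm] using this
    have : ∀ S : Fin s → Fin n × Fin m,
        max 0 (wTrNorm (checkR S) (checkC S) (((0:ℝ)⁻¹) • Xstar) - 1) = 0 := by
      intro S
      exact max_eq_left (by linarith [hz (checkR S) (checkC S)])
    simp only [this]
    simp only [sub_zero, one_smul, sub_self, Esample, mul_zero, Finset.sum_const_zero]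
    positivity
  obtain ⟨U, V, hX, hU, hV⟩ := wTrNorm_factor _ _ hsR hsC Xstar rho hpos rfl
  set u : Fin n → ℝ := fun i => ∑ k, U i k ^ 2 with hu
  set v : Fin m → ℝ := fun j => ∑ k, V j k ^ 2 with hv
  change ∑ i, smoothR p i * u i = 1 at hU
  change ∑ j, smoothC p j * v j = 1 at hV
  have hu0 : ∀ i, 0 ≤ u i := fun i => Finset.sum_nonneg fun _ _ => sq_nonneg _
  have hv0 : ∀ i, 0 ≤ v i := fun i => Finset.sum_nonneg fun _ _ => sq_nonneg _
  have hub : ∀ i, u i ≤ 2 * n := by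
    intro i
    have h1 : smoothR p i * u i ≤ 1 := by
      rw [← hU]
      exact Finset.single_le_sum (f := fun i => smoothR p i * u i)
        (fun i _ => mul_nonneg (hsR i).le (hu0 i)) (Finset.mem_univ i)
    have h2 : 1 / (2 * (n:ℝ)) ≤ smoothR p i := by
      have := hrow0 i
      unfold smoothR; linarith
    have h3 := (mul_le_mul_of_nonneg_right h2 (hu0 i)).trans h1
    rw [one_div_mul_eq_div, div_le_one (by positivity)] at h3
    exact h3
  have hvb : ∀ i, v i ≤ 2 * n := by
    intro i
    have h1 : smoothC p i * v i ≤ 1 := by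
      rw [← hV]
      exact Finset.single_le_sum (f := fun i => smoothC p i * v i)
        (fun i _ => mul_nonneg (hsC i).le (hv0 i)) (Finset.mem_univ i)
    have h2 : 1 / (2 * (m:ℝ)) ≤ smoothC p i := by
      have := hcol0 i
      unfold smoothC; linarith
    have h3 := (mul_le_mul_of_nonneg_right h2 (hv0 i)).trans h1
    rw [one_div_mul_eq_div, div_le_one (by positivity)] at h3
    linarith
  -- identities for smoothed sums
  have hUe : (∑ i, rowMarg p i * u i) / 2 + (∑ i, u i) / (2 * n) = 1 := by
    rw [← hU, Finset.sum_div, Finset.sum_div, ← Finset.sum_add_distrib]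
    exact Finset.sum_congr rfl fun i _ => by unfold smoothR; ring
  have hVe : (∑ i, colMarg p i * v i) / 2 + (∑ i, v i) / (2 * m) = 1 := by
    rw [← hV, Finset.sum_div, Finset.sum_div, ← Finset.sum_add_distrib]
    exact Finset.sum_congr rfl fun i _ => by unfold smoothC; ring
  have hsu : 0 ≤ (∑ i, u i) / (2 * n) :=
    div_nonneg (Finset.sum_nonneg fun i _ => hu0 i) (by positivity)
  have hsv : 0 ≤ (∑ i, v i) / (2 * m) :=
    div_nonneg (Finset.sum_nonneg fun i _ => hv0 i) (by positivity)
  set w : Fin n × Fin m → ℝ := fun a => p a.1 a.2 with hw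
  set Z : Fin n × Fin m → ℝ := fun a => u a.1 + v a.2 with hZ
  have hw0 : ∀ a, 0 ≤ w a := fun a => hp0 _ _
  have hw1 : ∑ a, w a = 1 := by rw [Fintype.sum_prod_type]; exact hp1
  set mu := ∑ a, w a * Z a with hmu
  have hmue : mu = ∑ i, rowMarg p i * u i + ∑ j, colMarg p j * v j := by
    have e1 : ∑ i, rowMarg p i * u i = ∑ i, ∑ j, p i j * u i :=
      Finset.sum_congr rfl fun i _ => by rw [rowMarg, Finset.sum_mul]
    have e2 : ∑ j, colMarg p j * v j = ∑ i, ∑ j, p i j * v j := by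
      rw [Finset.sum_comm]
      exact Finset.sum_congr rfl fun i _ => by rw [colMarg, Finset.sum_mul]
    rw [e1, e2, hmu, Fintype.sum_prod_type, ← Finset.sum_add_distrib]
    refine Finset.sum_congr rfl fun i _ => ?_
    rw [← Finset.sum_add_distrib]
    exact Finset.sum_congr rfl fun j _ => by simp only [hw, hZ]; ring
  have hmu4 : mu ≤ 4 := by rw [hmue]; linarith
  set g : Fin n × Fin m → ℝ := fun a => Z a - mu with hg
  have hg0 : ∑ a, w a * g a = 0 := by
    simp only [hg, mul_sub]
    rw [Finset.sum_sub_distrib, ← Finset.sum_mul, hw1, ← hmu]; ring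
  have hg2 : ∑ a, w a * g a ^ 2 ≤ 16 * n := by
    have e : ∑ a, w a * g a ^ 2 = ∑ a, w a * Z a ^ 2 - mu ^ 2 := by
      have : ∀ a, w a * g a ^ 2 = w a * Z a ^ 2 - 2 * mu * (w a * Z a) + mu ^ 2 * w a := by
        intro a; simp only [hg]; ring
      simp only [this]
      rw [Finset.sum_add_distrib, Finset.sum_sub_distrib, ← Finset.mul_sum, ← Finset.mul_sum, hw1,
        ← hmu]
      ring
    have h2 : ∑ a, w a * Z a ^ 2 ≤ 4 * n * mu := by
      rw [hmu, Finset.mul_sum]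
      refine Finset.sum_le_sum fun a _ => ?_
      have hz0 : 0 ≤ Z a := add_nonneg (hu0 _) (hv0 _)
      have hz1 : Z a ≤ 4 * n := by
        have := hub a.1; have := hvb a.2
        simp only [hZ]; linarith
      have : Z a ^ 2 ≤ 4 * n * Z a := by
        rw [pow_two]; exact mul_le_mul_of_nonneg_right hz1 hz0
      calc _ ≤ w a * (4 * n * Z a) := mul_le_mul_of_nonneg_left this (hw0 a)
        _ = _ := by ring
    have h3 : 4 * n * mu ≤ 4 * n * 4 := by gcongr
    rw [e]; nlinarith [sq_nonneg mu]
  set c : (Fin s → Fin n × Fin m) → ℝ := fun S =>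
    max 0 (wTrNorm (checkR S) (checkC S) (rho⁻¹ • Xstar) - 1) with hc
  have hcb : ∀ S, c S ≤ max 0 (1 / (4 * s) * ∑ t, g (S t)) := by
    intro S
    refine max_le_max le_rfl ?_
    have hR0 : ∀ i, 0 ≤ checkR S i := fun i => by unfold checkR empRowMarg; positivity
    have hC0 : ∀ i, 0 ≤ checkC S i := fun i => by unfold checkC empColMarg; positivity
    have h1 := wTrNorm_le (checkR S) (checkC S) hR0 hC0 (rho⁻¹ • Xstar) U V (by
      intro i j
      rw [Matrix.smul_apply, hX, smul_eq_mul, inv_mul_cancel_left₀ hpos.ne'])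
    change _ ≤ (∑ i, checkR S i * u i + ∑ j, checkC S j * v j) / 2 at h1
    have e1 : ∑ i, checkR S i * u i = (1 / s * ∑ t, u (S t).1) / 2 + (∑ i, u i) / (2 * n) := by
      rw [← sum_empRow, Finset.sum_div, Finset.sum_div, ← Finset.sum_add_distrib]
      exact Finset.sum_congr rfl fun i _ => by unfold checkR; ring
    have e2 : ∑ i, checkC S i * v i = (1 / s * ∑ t, v (S t).2) / 2 + (∑ i, v i) / (2 * m) := by
      rw [← sum_empCol, Finset.sum_div, Finset.sum_div, ← Finset.sum_add_distrib]
      exact Finset.sum_congr rfl fun i _ => by unfold checkC; ring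
    have e3 : 1 / (4 * (s:ℝ)) * ∑ t, g (S t) =
        (1 / s * ∑ t, u (S t).1) / 4 + (1 / s * ∑ t, v (S t).2) / 4 - mu / 4 := by
      simp only [hg, hZ]
      rw [Finset.sum_sub_distrib, Finset.sum_add_distrib]
      simp only [Finset.sum_const, Finset.card_univ, Fintype.card_fin, nsmul_eq_mul]
      field_simp
    rw [e3, hmue]
    rw [e1, e2] at h1
    linarith
  have hc0 : ∀ S, 0 ≤ c S := fun S => le_max_left _ _
  have hEc := iid_pos_part w g hw0 hw1 hg0 s hs n hn' hg2 c hcb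
  have hEX : ∑ i, ∑ j, p i j * |Xstar i j| ≤ 2 * rho := by
    have : ∑ i, ∑ j, p i j * |Xstar i j| ≤ ∑ i, ∑ j, rho / 2 * (w (i, j) * Z (i, j)) := by
      refine Finset.sum_le_sum fun i _ => Finset.sum_le_sum fun j _ => ?_
      have h1 : |∑ k, U i k * V j k| ≤ (u i + v j) / 2 := by
        refine (Finset.abs_sum_le_sum_abs _ _).trans ?_
        simp only [hu, hv]
        rw [← Finset.sum_add_distrib, Finset.sum_div]
        refine Finset.sum_le_sum fun k _ => ?_
        rw [abs_mul, ← sq_abs (U i k), ← sq_abs (V j k)]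
        nlinarith [sq_nonneg (|U i k| - |V j k|)]
      rw [hX, abs_mul, abs_of_pos hpos]
      calc _ ≤ p i j * (rho * ((u i + v j) / 2)) :=
            mul_le_mul_of_nonneg_left (mul_le_mul_of_nonneg_left h1 hpos.le) (hp0 i j)
        _ = _ := by simp only [hw, hZ]; ring
    refine this.trans ?_
    rw [← Fintype.sum_prod_type (f := fun a => rho / 2 * (w a * Z a)), ← Finset.mul_sum, ← hmu]
    nlinarith
  have hdiff : ∀ S, popRisk p ℓ Y ((1 - c S) • Xstar) - popRisk p ℓ Y Xstar ≤
      c S * (l * (2 * rho)) := by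
    intro S
    have h1 : popRisk p ℓ Y ((1 - c S) • Xstar) - popRisk p ℓ Y Xstar ≤
        ∑ i, ∑ j, c S * l * (p i j * |Xstar i j|) := by
      unfold popRisk
      rw [← Finset.sum_sub_distrib]
      refine Finset.sum_le_sum fun i _ => ?_
      rw [← Finset.sum_sub_distrib]
      refine Finset.sum_le_sum fun j _ => ?_
      have h2 := (le_abs_self _).trans (hL (((1 - c S) • Xstar) i j) (Xstar i j) (Y i j))
      have h3 : ((1 - c S) • Xstar) i j - Xstar i j = -(c S * Xstar i j) := by
        rw [Matrix.smul_apply, smul_eq_mul]; ring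
      rw [h3, abs_neg, abs_mul, abs_of_nonneg (hc0 S)] at h2
      rw [← mul_sub]
      calc _ ≤ p i j * (l * (c S * |Xstar i j|)) := mul_le_mul_of_nonneg_left h2 (hp0 i j)
        _ = _ := by ring
    simp only [← Finset.mul_sum] at h1
    refine h1.trans ?_
    rw [← mul_assoc (c S)]
    exact mul_le_mul_of_nonneg_left hEX (mul_nonneg (hc0 S) hl)
  change Esample s p (fun S => popRisk p ℓ Y ((1 - c S) • Xstar) - popRisk p ℓ Y Xstar) ≤ _
  have hfin : Esample s p (fun S => popRisk p ℓ Y ((1 - c S) • Xstar) - popRisk p ℓ Y Xstar) ≤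
      l * (2 * rho) * ∑ S : Fin s → Fin n × Fin m, (∏ t, w (S t)) * c S := by
    unfold Esample sampleProb
    rw [Finset.mul_sum]
    refine Finset.sum_le_sum fun S _ => ?_
    calc _ ≤ (∏ t, w (S t)) * (c S * (l * (2 * rho))) :=
          mul_le_mul_of_nonneg_left (hdiff S) (Finset.prod_nonneg fun _ _ => hw0 _)
      _ = _ := by ring
  refine hfin.trans ((mul_le_mul_of_nonneg_left hEc (by positivity)).trans ?_)
  refine Real.le_sqrt_of_sq_le ?_
  have e : (l * (2 * rho) * (Real.sqrt ((n:ℝ) / s) / 2)) ^ 2 = l ^ 2 * rho ^ 2 * (n / s) := by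
    have : Real.sqrt ((n:ℝ) / s) ^ 2 = n / s := Real.sq_sqrt (by positivity)
    calc _ = l ^ 2 * rho ^ 2 * Real.sqrt ((n:ℝ) / s) ^ 2 := by ring
      _ = _ := by rw [this]
  rw [e, hXstar]
  have h1 : l ^ 2 * rstar * ((n:ℝ) / s) ≤ l ^ 2 * r * (n / s) := by gcongr
  have h2 : 0 ≤ l ^ 2 * r * ((n:ℝ) / s) := by positivity
  calc _ ≤ 2 * (l ^ 2 * r * ((n:ℝ) / s)) := by linarith
    _ = _ := by ring


end
end

section
/- Let p be any probability distribution on [n]×[m] and fix a matrix X ∈ ℝ^{n×m} with smoothed-weighted trace-norm ‖X‖_tr(p̃) = 1. Then, in expectation over a sample S of size s drawn i.i.d. from p, E_S[max{0, ‖X‖_tr(p̌) − 1}] ≤ √(n/(2s)), where p̌ are the smoothed empirical marginals of S. -/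
open scoped Classical
open Matrix Finset

noncomputable section

theorem tn_trace_nonneg {k l : ℕ} (M : Matrix (Fin k) (Fin l) ℝ) : 0 ≤ (Mᵀ * M).trace := by
  simp only [Matrix.trace, Matrix.diag, Matrix.mul_apply, Matrix.transpose_apply]
  exact Finset.sum_nonneg fun i _ => Finset.sum_nonneg fun j _ => mul_self_nonneg _

theorem tn_spec {n m : ℕ} (A : Matrix (Fin n) (Fin m) ℝ) :
    ∃ (V : Matrix (Fin m) (Fin m) ℝ) (e : Fin m → ℝ), (∀ j, 0 ≤ e j) ∧ V * Vᵀ = 1 ∧ Vᵀ * V = 1 ∧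
      (A * V)ᵀ * (A * V) = Matrix.diagonal (fun j => e j * e j) ∧ traceNorm A = ∑ j, e j := by
  have hH := Matrix.isHermitian_conjTranspose_mul_self A
  have hpos : ∀ j, 0 ≤ hH.eigenvalues j :=
    fun j => (Matrix.posSemidef_conjTranspose_mul_self A).eigenvalues_nonneg j
  set V : Matrix (Fin m) (Fin m) ℝ := (hH.eigenvectorUnitary : Matrix (Fin m) (Fin m) ℝ) with hV
  have h1 : V * Vᵀ = 1 := by
    rw [← Matrix.conjTranspose_eq_transpose_of_trivial V]
    exact Unitary.coe_mul_star_self hH.eigenvectorUnitary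
  have h2 : Vᵀ * V = 1 := by
    rw [← Matrix.conjTranspose_eq_transpose_of_trivial V]
    exact Unitary.coe_star_mul_self hH.eigenvectorUnitary
  refine ⟨V, fun j => Real.sqrt (hH.eigenvalues j), fun j => Real.sqrt_nonneg _, h1, h2, ?_, rfl⟩
  have h3 : Aᵀ * A = V * Matrix.diagonal hH.eigenvalues * Vᵀ := by
    have := hH.spectral_theorem
    rw [Unitary.conjStarAlgAut_apply] at this
    rw [Matrix.star_eq_conjTranspose] at this
    rw [← Matrix.conjTranspose_eq_transpose_of_trivial A,
      ← Matrix.conjTranspose_eq_transpose_of_trivial V]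
    exact this
  have h4 : (A * V)ᵀ * (A * V) = Vᵀ * (Aᵀ * A) * V := by
    simp only [Matrix.transpose_mul, Matrix.mul_assoc]
  rw [h4, h3]
  have h5 : Vᵀ * (V * Matrix.diagonal hH.eigenvalues * Vᵀ) * V
      = (Vᵀ * V) * Matrix.diagonal hH.eigenvalues * (Vᵀ * V) := by
    simp only [Matrix.mul_assoc]
  rw [h5, h2]
  simp only [Matrix.one_mul, Matrix.mul_one]
  congr 1
  funext j
  exact (Real.mul_self_sqrt (hpos j)).symm

theorem tn_col_zero {n m : ℕ} (W : Matrix (Fin n) (Fin m) ℝ) (d : Fin m → ℝ)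
    (h : Wᵀ * W = Matrix.diagonal d) (j : Fin m) (hj : d j = 0) (i : Fin n) : W i j = 0 := by
  have := congrFun (congrFun h j) j
  simp only [Matrix.mul_apply, Matrix.transpose_apply, Matrix.diagonal_apply_eq, hj] at this
  rw [Finset.sum_eq_zero_iff_of_nonneg (fun i _ => mul_self_nonneg _)] at this
  exact mul_self_eq_zero.mp (this i (Finset.mem_univ i))

theorem tn_factor {n m : ℕ} (A : Matrix (Fin n) (Fin m) ℝ) :
    ∃ (B : Matrix (Fin n) (Fin m) ℝ) (C : Matrix (Fin m) (Fin m) ℝ), A = B * Cᵀ ∧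
      (Bᵀ * B).trace = traceNorm A ∧ (Cᵀ * C).trace = traceNorm A := by
  obtain ⟨V, e, he, h1, h2, h3, h4⟩ := tn_spec A
  refine ⟨A * V * Matrix.diagonal (fun j => (Real.sqrt (e j))⁻¹),
    V * Matrix.diagonal (fun j => Real.sqrt (e j)), ?_, ?_, ?_⟩
  · have : A * V * Matrix.diagonal (fun j => (Real.sqrt (e j))⁻¹) *
        Matrix.diagonal (fun j => Real.sqrt (e j)) = A * V := by
      rw [Matrix.mul_assoc, Matrix.diagonal_mul_diagonal]
      ext i j
      rw [Matrix.mul_diagonal]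
      by_cases hj : e j = 0
      · rw [tn_col_zero (A * V) _ h3 j (by simp [hj]) i, zero_mul]
      · have : Real.sqrt (e j) ≠ 0 := by
          rw [Real.sqrt_ne_zero (he j)]; exact hj
        rw [inv_mul_cancel₀ this, mul_one]
    rw [Matrix.transpose_mul, Matrix.diagonal_transpose, ← Matrix.mul_assoc, this,
      Matrix.mul_assoc, h1, Matrix.mul_one]
  · rw [Matrix.transpose_mul, Matrix.diagonal_transpose, Matrix.mul_assoc,
      ← Matrix.mul_assoc (A * V)ᵀ, h3, Matrix.diagonal_mul_diagonal, Matrix.diagonal_mul_diagonal,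
      Matrix.trace_diagonal, h4]
    refine Finset.sum_congr rfl fun j _ => ?_
    by_cases hj : e j = 0
    · simp [hj]
    · have h5 : Real.sqrt (e j) ≠ 0 := by
        rw [Real.sqrt_ne_zero (he j)]; exact hj
      have h6 := Real.mul_self_sqrt (he j)
      field_simp
      nlinarith
  · rw [Matrix.transpose_mul, Matrix.diagonal_transpose, Matrix.mul_assoc,
      ← Matrix.mul_assoc Vᵀ, h2, Matrix.one_mul, Matrix.diagonal_mul_diagonal,
      Matrix.trace_diagonal, h4]
    exact Finset.sum_congr rfl fun j _ => Real.mul_self_sqrt (he j)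

theorem tn_le {n m : ℕ} (B : Matrix (Fin n) (Fin m) ℝ) (C : Matrix (Fin m) (Fin m) ℝ) :
    traceNorm (B * Cᵀ) ≤ ((Bᵀ * B).trace + (Cᵀ * C).trace) / 2 := by
  obtain ⟨V, e, he, h1, h2, h3, h4⟩ := tn_spec (B * Cᵀ)
  set W := B * Cᵀ * V with hW
  set D : Matrix (Fin m) (Fin m) ℝ := Matrix.diagonal (fun j => (e j)⁻¹) with hD
  set U := W * D with hU
  have hDt : Dᵀ = D := Matrix.diagonal_transpose _
  have hUU : U * (Uᵀ * U) = U := by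
    rw [hU, Matrix.transpose_mul, hDt, Matrix.mul_assoc D, ← Matrix.mul_assoc Wᵀ, h3, hD]
    simp only [Matrix.diagonal_mul_diagonal, Matrix.mul_assoc]
    congr 2
    funext j
    by_cases hj : e j = 0
    · simp [hj]
    · field_simp
  have htr : (Uᵀ * W).trace = traceNorm (B * Cᵀ) := by
    rw [hU, Matrix.transpose_mul, hDt, Matrix.mul_assoc, h3, hD, Matrix.diagonal_mul_diagonal,
      Matrix.trace_diagonal, h4]
    refine Finset.sum_congr rfl fun j _ => ?_
    by_cases hj : e j = 0
    · simp [hj]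
    · field_simp
  -- Bessel
  have hb : ((Bᵀ * U) * (Uᵀ * B)).trace ≤ (Bᵀ * B).trace := by
    have h := tn_trace_nonneg (B - U * (Uᵀ * B))
    have hexp : (B - U * (Uᵀ * B))ᵀ * (B - U * (Uᵀ * B)) = Bᵀ * B - (Bᵀ * U) * (Uᵀ * B) := by
      have h6 : U * (Uᵀ * (U * (Uᵀ * B))) = U * (Uᵀ * B) := by
        have := congrArg (· * (Uᵀ * B)) hUU
        simpa only [Matrix.mul_assoc] using this
      simp only [Matrix.transpose_sub, Matrix.transpose_mul, Matrix.transpose_transpose,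
        Matrix.sub_mul, Matrix.mul_sub, Matrix.mul_assoc, h6]
      abel
    rw [hexp, Matrix.trace_sub] at h
    linarith
  have hc : ((Vᵀ * C) * (Cᵀ * V)).trace = (Cᵀ * C).trace := by
    rw [Matrix.trace_mul_comm]
    have : (Cᵀ * V) * (Vᵀ * C) = Cᵀ * (V * Vᵀ) * C := by simp only [Matrix.mul_assoc]
    rw [this, h1, Matrix.mul_one]
  have hq := tn_trace_nonneg (Bᵀ * U - Cᵀ * V)
  have hexp : ((Bᵀ * U - Cᵀ * V)ᵀ * (Bᵀ * U - Cᵀ * V)).trace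
      = ((Bᵀ * U) * (Uᵀ * B)).trace + ((Vᵀ * C) * (Cᵀ * V)).trace - 2 * (Uᵀ * W).trace := by
    have e1 : ((Uᵀ * B) * (Bᵀ * U)).trace = ((Bᵀ * U) * (Uᵀ * B)).trace :=
      Matrix.trace_mul_comm _ _
    have e2 : ((Uᵀ * B) * (Cᵀ * V)).trace = (Uᵀ * W).trace := by
      rw [hW]; simp only [Matrix.mul_assoc]
    have e3 : ((Vᵀ * C) * (Bᵀ * U)).trace = (Uᵀ * W).trace := by
      rw [← e2, ← Matrix.trace_transpose]
      simp only [Matrix.transpose_mul, Matrix.transpose_transpose]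
    simp only [Matrix.transpose_sub, Matrix.transpose_mul, Matrix.transpose_transpose,
        Matrix.sub_mul, Matrix.mul_sub, Matrix.trace_sub, e1, e2, e3]
    ring
  rw [hexp, htr, hc] at hq
  linarith

theorem tn_trace_eq {k l : ℕ} (M : Matrix (Fin k) (Fin l) ℝ) :
    (Mᵀ * M).trace = ∑ i, ∑ j, M i j ^ 2 := by
  simp only [Matrix.trace, Matrix.diag, Matrix.mul_apply, Matrix.transpose_apply]
  rw [Finset.sum_comm]
  exact Finset.sum_congr rfl fun i _ => Finset.sum_congr rfl fun j _ => (sq _).symm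

theorem tn_weighted {n m : ℕ} (X : Matrix (Fin n) (Fin m) ℝ) (a : Fin n → ℝ) (b : Fin m → ℝ)
    (ha : ∀ i, 0 < a i) (hb : ∀ j, 0 < b j) (hX : wTrNorm a b X = 1) :
    ∃ (β : Fin n → ℝ) (γ : Fin m → ℝ), (∀ i, 0 ≤ β i) ∧ (∀ j, 0 ≤ γ j) ∧
      ∑ i, β i = 1 ∧ ∑ j, γ j = 1 ∧
      ∀ (a' : Fin n → ℝ) (b' : Fin m → ℝ), (∀ i, 0 ≤ a' i) → (∀ j, 0 ≤ b' j) →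
        wTrNorm a' b' X ≤ (∑ i, a' i / a i * β i + ∑ j, b' j / b j * γ j) / 2 := by
  obtain ⟨B, C, h1, h2, h3⟩ := tn_factor (Matrix.diagonal (fun i => Real.sqrt (a i)) * X *
    Matrix.diagonal (fun j => Real.sqrt (b j)))
  have hX' := hX
  unfold wTrNorm at hX'
  rw [hX', tn_trace_eq] at h2 h3
  refine ⟨fun i => ∑ j, B i j ^ 2, fun i => ∑ j, C i j ^ 2,
    fun i => Finset.sum_nonneg fun j _ => sq_nonneg _,
    fun i => Finset.sum_nonneg fun j _ => sq_nonneg _, h2, h3, ?_⟩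
  intro a' b' ha' hb'
  have key : Matrix.diagonal (fun i => Real.sqrt (a' i)) * X *
      Matrix.diagonal (fun j => Real.sqrt (b' j)) =
      (Matrix.diagonal (fun i => Real.sqrt (a' i) / Real.sqrt (a i)) * B) *
      (Matrix.diagonal (fun i => Real.sqrt (b' i) / Real.sqrt (b i)) * C)ᵀ := by
    rw [Matrix.transpose_mul, Matrix.diagonal_transpose, Matrix.mul_assoc (Matrix.diagonal _) B,
      ← Matrix.mul_assoc B, ← h1]
    ext i j
    simp only [Matrix.mul_diagonal, Matrix.diagonal_mul]
    have := (Real.sqrt_pos.mpr (ha i)).ne'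
    have := (Real.sqrt_pos.mpr (hb j)).ne'
    field_simp
  unfold wTrNorm
  rw [key]
  refine (tn_le _ _).trans (le_of_eq ?_)
  rw [tn_trace_eq, tn_trace_eq]
  congr 2
  · refine Finset.sum_congr rfl fun i _ => ?_
    rw [Finset.mul_sum]
    refine Finset.sum_congr rfl fun j _ => ?_
    rw [Matrix.diagonal_mul, mul_pow, div_pow, Real.sq_sqrt (ha' i), Real.sq_sqrt (ha i).le]
  · refine Finset.sum_congr rfl fun i _ => ?_
    rw [Finset.mul_sum]
    refine Finset.sum_congr rfl fun j _ => ?_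
    rw [Matrix.diagonal_mul, mul_pow, div_pow, Real.sq_sqrt (hb' i), Real.sq_sqrt (hb i).le]

theorem iid_succ {Ω : Type*} [Fintype Ω] (s : ℕ) (F : (Fin (s + 1) → Ω) → ℝ) :
    ∑ S, F S = ∑ x, ∑ S : Fin s → Ω, F (Fin.cons x S) := by
  rw [← Fintype.sum_prod_type' (f := fun x (S : Fin s → Ω) => F (Fin.cons x S))]
  exact (Fintype.sum_equiv (Fin.consEquiv (fun _ => Ω)) _ _ (fun _ => rfl)).symm

theorem iid_moments_s14 {Ω : Type*} [Fintype Ω] (q h : Ω → ℝ) (hq : ∑ x, q x = 1)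
    (hh : ∑ x, q x * h x = 0) (s : ℕ) :
    (∑ S : Fin s → Ω, ∏ t, q (S t)) = 1 ∧
    (∑ S : Fin s → Ω, (∏ t, q (S t)) * ∑ t, h (S t)) = 0 ∧
    (∑ S : Fin s → Ω, (∏ t, q (S t)) * (∑ t, h (S t)) ^ 2) = s * ∑ x, q x * h x ^ 2 := by
  induction s with
  | zero => simp
  | succ s ih =>
    obtain ⟨i1, i2, i3⟩ := ih
    refine ⟨?_, ?_, ?_⟩
    · rw [iid_succ]
      simp only [Fin.prod_univ_succ, Fin.cons_zero, Fin.cons_succ, ← Finset.mul_sum, i1, mul_one, hq]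
    · rw [iid_succ]
      simp only [Fin.prod_univ_succ, Fin.sum_univ_succ, Fin.cons_zero, Fin.cons_succ]
      have : ∀ x, ∑ S : Fin s → Ω, q x * (∏ t, q (S t)) * (h x + ∑ t, h (S t)) = q x * h x := by
        intro x
        calc _ = q x * h x * (∑ S : Fin s → Ω, ∏ t, q (S t)) +
            q x * (∑ S : Fin s → Ω, (∏ t, q (S t)) * ∑ t, h (S t)) := by
              rw [Finset.mul_sum, Finset.mul_sum, ← Finset.sum_add_distrib]
              exact Finset.sum_congr rfl fun S _ => by ring
          _ = _ := by rw [i1, i2]; ring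
      simp only [this, hh]
    · rw [iid_succ]
      simp only [Fin.prod_univ_succ, Fin.sum_univ_succ, Fin.cons_zero, Fin.cons_succ]
      have : ∀ x, ∑ S : Fin s → Ω, q x * (∏ t, q (S t)) * (h x + ∑ t, h (S t)) ^ 2
          = q x * h x ^ 2 + q x * (s * ∑ x, q x * h x ^ 2) := by
        intro x
        calc _ = q x * h x ^ 2 * (∑ S : Fin s → Ω, ∏ t, q (S t)) +
            2 * q x * h x * (∑ S : Fin s → Ω, (∏ t, q (S t)) * ∑ t, h (S t)) +
            q x * (∑ S : Fin s → Ω, (∏ t, q (S t)) * (∑ t, h (S t)) ^ 2) := by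
              rw [Finset.mul_sum, Finset.mul_sum, Finset.mul_sum, ← Finset.sum_add_distrib,
                ← Finset.sum_add_distrib]
              exact Finset.sum_congr rfl fun S _ => by ring
          _ = _ := by rw [i1, i2, i3]; ring
      simp only [this, Finset.sum_add_distrib, ← Finset.sum_mul, hq]
      push_cast
      ring

theorem marg_bound {k : ℕ} (r : Fin k → ℝ) (β : Fin k → ℝ) (hk : 1 ≤ k) (hr : ∀ i, 0 ≤ r i)
    (hβ : ∀ i, 0 ≤ β i) (hs : ∑ i, β i = 1) :
    ∑ i, r i * (β i / (2 * (r i / 2 + 1 / (2 * (k : ℝ))))) ^ 2 ≤ (k : ℝ) / 4 := by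
  have hk' : (0 : ℝ) < k := by exact_mod_cast hk
  calc _ ≤ ∑ i, (k : ℝ) / 4 * β i := by
        refine Finset.sum_le_sum fun i _ => ?_
        have hb1 : β i ≤ 1 := hs ▸ Finset.single_le_sum (fun i _ => hβ i) (Finset.mem_univ i)
        have e : r i * (β i / (2 * (r i / 2 + 1 / (2 * (k : ℝ))))) ^ 2
            = (r i / (r i + 1 / k) ^ 2) * β i ^ 2 := by
          have : 2 * (r i / 2 + 1 / (2 * (k : ℝ))) = r i + 1 / k := by field_simp
          rw [this, div_pow]; ring
        rw [e]
        have hpos : 0 < r i + 1 / (k : ℝ) := by have := hr i; positivity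
        have h1 : r i / (r i + 1 / (k : ℝ)) ^ 2 ≤ k / 4 := by
          rw [div_le_iff₀ (by positivity)]
          have h3 : (k : ℝ) / 4 * (r i + 1 / k) ^ 2 - r i = k / 4 * (r i - 1 / k) ^ 2 := by
            field_simp; ring
          have : 0 ≤ (k : ℝ) / 4 * (r i - 1 / k) ^ 2 := by positivity
          linarith
        have h2 : β i ^ 2 ≤ β i := by nlinarith [hβ i]
        exact mul_le_mul h1 h2 (sq_nonneg _) (by positivity)
    _ = _ := by rw [← Finset.mul_sum, hs, mul_one]

theorem emp_sum {k s : ℕ} {Ω : Type*} (S : Fin s → Ω) (f : Ω → Fin k) (w : Fin k → ℝ) :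
    ∑ i, ((Finset.univ.filter fun t => f (S t) = i).card : ℝ) / (s : ℝ) * w i
      = (∑ t, w (f (S t))) / s := by
  rw [Finset.sum_div]
  have : ∀ t, w (f (S t)) / s = ∑ i, if f (S t) = i then w i / s else 0 := by
    intro t; simp
  simp only [this]
  rw [Finset.sum_comm]
  refine Finset.sum_congr rfl fun i _ => ?_
  rw [← Finset.sum_filter, Finset.sum_const, nsmul_eq_mul]
  ring

/-- Lemma 4: for any distribution `p` and any fixed matrix `X` with
`‖X‖_tr(p̃) = 1`, we have `E_S[max{0, ‖X‖_tr(p̌) − 1}] ≤ √(n/(2s))`. -/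
theorem expected_empirical_traceNorm_excess
    (n m s : ℕ) (p : Matrix (Fin n) (Fin m) ℝ) (X : Matrix (Fin n) (Fin m) ℝ)
    (hm : 1 ≤ m) (hnm : m ≤ n) (hs : 1 ≤ s)
    (hp : IsDistrib p)
    (hX : wTrNorm (smoothR p) (smoothC p) X = 1) :
    Esample s p (fun S => max 0 (wTrNorm (checkR S) (checkC S) X - 1)) ≤
      Real.sqrt ((n : ℝ) / (2 * s)) := by
  obtain ⟨hp0, hp1⟩ := hp
  have hn : 1 ≤ n := hm.trans hnm
  have hn' : (0 : ℝ) < n := by exact_mod_cast hn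
  have hm' : (0 : ℝ) < m := by exact_mod_cast hm
  have hs' : (0 : ℝ) < s := by exact_mod_cast hs
  have hr0 : ∀ i, 0 ≤ rowMarg p i := fun i => Finset.sum_nonneg fun j _ => hp0 i j
  have hc0 : ∀ j, 0 ≤ colMarg p j := fun j => Finset.sum_nonneg fun i _ => hp0 i j
  have ha : ∀ i, 0 < smoothR p i := fun i => by
    have := hr0 i; unfold smoothR; positivity
  have hb : ∀ j, 0 < smoothC p j := fun j => by
    have := hc0 j; unfold smoothC; positivity
  obtain ⟨β, γ, hβ, hγ, hβ1, hγ1, hmain⟩ := tn_weighted X _ _ ha hb hX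
  set u : Fin n → ℝ := fun i => β i / (2 * smoothR p i) with hu
  set v : Fin m → ℝ := fun j => γ j / (2 * smoothC p j) with hv
  set q : Fin n × Fin m → ℝ := fun x => p x.1 x.2 with hq
  set g : Fin n × Fin m → ℝ := fun x => (u x.1 + v x.2) / 2 with hg
  set μ : ℝ := ∑ x, q x * g x with hμ
  have hq1 : ∑ x, q x = 1 := by rw [Fintype.sum_prod_type]; exact hp1
  have hq0 : ∀ x, 0 ≤ q x := fun x => hp0 _ _
  have hrow : ∀ w : Fin n → ℝ, ∑ x, q x * w x.1 = ∑ i, rowMarg p i * w i := fun w => by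
    rw [Fintype.sum_prod_type]
    simp only [hq, rowMarg, Finset.sum_mul]
  have hcol : ∀ w : Fin m → ℝ, ∑ x, q x * w x.2 = ∑ j, colMarg p j * w j := fun w => by
    rw [Fintype.sum_prod_type_right]
    simp only [hq, colMarg, Finset.sum_mul]
  have hμ' : μ = (∑ i, rowMarg p i * u i + ∑ j, colMarg p j * v j) / 2 := by
    rw [← hrow, ← hcol, ← Finset.sum_add_distrib, Finset.sum_div, hμ]
    exact Finset.sum_congr rfl fun x _ => by simp only [hg]; ring
  have hh0 : ∑ x, q x * (g x - μ) = 0 := by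
    simp only [mul_sub, Finset.sum_sub_distrib, ← Finset.sum_mul, hq1, one_mul]
    rw [← hμ, sub_self]
  obtain ⟨m1, -, m3⟩ := iid_moments_s14 q (fun x => g x - μ) hq1 hh0 s
  have hg2 : ∑ x, q x * g x ^ 2 ≤ n / 2 := by
    have b1 : ∑ i, rowMarg p i * u i ^ 2 ≤ n / 4 := marg_bound _ β hn hr0 hβ hβ1
    have b2 : ∑ j, colMarg p j * v j ^ 2 ≤ m / 4 := marg_bound _ γ hm hc0 hγ hγ1
    have b3 : (m : ℝ) ≤ n := by exact_mod_cast hnm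
    have : ∑ x, q x * g x ^ 2 ≤ ∑ x, (q x * u x.1 ^ 2 + q x * v x.2 ^ 2) := by
      refine Finset.sum_le_sum fun x _ => ?_
      rw [← mul_add]
      refine mul_le_mul_of_nonneg_left ?_ (hq0 x)
      simp only [hg]
      nlinarith [sq_nonneg (u x.1 - v x.2), sq_nonneg (u x.1), sq_nonneg (v x.2)]
    rw [Finset.sum_add_distrib, hrow (fun i => u i ^ 2), hcol (fun j => v j ^ 2)] at this
    linarith
  have hvar : ∑ x, q x * (g x - μ) ^ 2 ≤ n / 2 := by
    have : ∑ x, q x * (g x - μ) ^ 2 = ∑ x, q x * g x ^ 2 - 2 * μ * μ + μ ^ 2 := by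
      calc _ = ∑ x, (q x * g x ^ 2 - 2 * μ * (q x * g x) + μ ^ 2 * q x) :=
            Finset.sum_congr rfl fun x _ => by ring
        _ = _ := by
            rw [Finset.sum_add_distrib, Finset.sum_sub_distrib, ← Finset.mul_sum, ← Finset.mul_sum,
              hq1, ← hμ, mul_one]
    nlinarith [sq_nonneg μ]
  have hz : ∀ S : Fin s → Fin n × Fin m,
      wTrNorm (checkR S) (checkC S) X - 1 ≤ (∑ t, (g (S t) - μ)) / s := by
    intro S
    have h0 := hmain (checkR S) (checkC S)
      (fun i => by unfold checkR empRowMarg; positivity)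
      (fun j => by unfold checkC empColMarg; positivity)
    have e1 : ∑ i, checkR S i / smoothR p i * β i
        = (∑ t, u (S t).1) / s - ∑ i, rowMarg p i * u i + 1 := by
      rw [← emp_sum S Prod.fst u, ← hβ1, ← Finset.sum_sub_distrib, ← Finset.sum_add_distrib]
      refine Finset.sum_congr rfl fun i _ => ?_
      have hne := (ha i).ne'
      have hd : checkR S i = (empRowMarg S i - rowMarg p i) / 2 + smoothR p i := by
        unfold checkR smoothR; field_simp; ring
      change _ = empRowMarg S i * u i - _ + _
      rw [hd]
      simp only [hu]
      field_simp
      try ring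
    have e2 : ∑ i, checkC S i / smoothC p i * γ i
        = (∑ t, v (S t).2) / s - ∑ i, colMarg p i * v i + 1 := by
      rw [← emp_sum S Prod.snd v, ← hγ1, ← Finset.sum_sub_distrib, ← Finset.sum_add_distrib]
      refine Finset.sum_congr rfl fun i _ => ?_
      have hne := (hb i).ne'
      have hd : checkC S i = (empColMarg S i - colMarg p i) / 2 + smoothC p i := by
        unfold checkC smoothC; field_simp; ring
      change _ = empColMarg S i * v i - _ + _
      rw [hd]
      simp only [hv]
      field_simp
      try ring
    have e3 : (∑ t, (g (S t) - μ)) / s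
        = ((∑ t, u (S t).1) / s + (∑ t, v (S t).2) / s) / 2 - μ := by
      simp only [hg, Finset.sum_sub_distrib, Finset.sum_const, Finset.card_univ, Fintype.card_fin,
        nsmul_eq_mul, ← Finset.sum_div, Finset.sum_add_distrib]
      field_simp
    rw [e1, e2] at h0
    rw [e3, hμ']
    linarith
  set c := Real.sqrt ((n : ℝ) / (2 * s)) with hc
  have hcpos : 0 < c := Real.sqrt_pos.mpr (by positivity)
  have hc2 : c ^ 2 = (n : ℝ) / (2 * s) := Real.sq_sqrt (by positivity)
  have hpt : ∀ S : Fin s → Fin n × Fin m,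
      max 0 (wTrNorm (checkR S) (checkC S) X - 1)
        ≤ (∑ t, (g (S t) - μ)) ^ 2 * (1 / (2 * c * s ^ 2)) + c / 2 := by
    intro S
    have h1 : (∑ t, (g (S t) - μ)) ^ 2 * (1 / (2 * c * s ^ 2)) + c / 2 - (∑ t, (g (S t) - μ)) / s
        = ((∑ t, (g (S t) - μ)) / s - c) ^ 2 / (2 * c) := by
      field_simp; ring
    have h2 : 0 ≤ ((∑ t, (g (S t) - μ)) / s - c) ^ 2 / (2 * c) := by positivity
    refine max_le (by positivity) ?_
    linarith [hz S]
  have hprob : ∀ S : Fin s → Fin n × Fin m, 0 ≤ ∏ t, q (S t) :=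
    fun S => Finset.prod_nonneg fun t _ => hq0 _
  calc Esample s p (fun S => max 0 (wTrNorm (checkR S) (checkC S) X - 1))
      ≤ ∑ S : Fin s → Fin n × Fin m, (∏ t, q (S t)) *
        ((∑ t, (g (S t) - μ)) ^ 2 * (1 / (2 * c * s ^ 2)) + c / 2) :=
        Finset.sum_le_sum fun S _ => mul_le_mul_of_nonneg_left (hpt S) (hprob S)
    _ = (s * ∑ x, q x * (g x - μ) ^ 2) * (1 / (2 * c * s ^ 2)) + 1 * (c / 2) := by
        rw [← m3, ← m1, Finset.sum_mul, Finset.sum_mul, ← Finset.sum_add_distrib]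
        exact Finset.sum_congr rfl fun S _ => by ring
    _ ≤ (s * (n / 2)) * (1 / (2 * c * s ^ 2)) + 1 * (c / 2) := by gcongr
    _ = c ^ 2 / (2 * c) + c / 2 := by rw [hc2]; field_simp
    _ = c := by field_simp; ring

end
end

section
/- Let p be any probability distribution on [n]×[m] with smoothed marginals p̃, and define the matrix M ∈ ℝ^{n×m} by M_{ij} = p(i,j)/√(p̃^r(i)·p̃^c(j)). Then the spectral norm (largest singular value) of M satisfies ‖M‖_sp ≤ 2. -/
open scoped Classical
open Matrix Finset

noncomputable section

/-- Spectral norm (largest singular value) of a real matrix, characterized as the supremum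
of `uᵀ M v` over unit vectors `u, v`. -/
def spNorm {n m : ℕ} (M : Matrix (Fin n) (Fin m) ℝ) : ℝ :=
  sSup {x : ℝ | ∃ (u : Fin n → ℝ) (v : Fin m → ℝ),
    (∑ i, u i ^ 2) = 1 ∧ (∑ j, v j ^ 2) = 1 ∧ x = ∑ i, ∑ j, u i * M i j * v j}

/-- for any probability distribution `p` on `[n] × [m]` with smoothed
marginals `p̃`, the matrix `M_{ij} = p(i,j)/√(p̃^r(i)·p̃^c(j))` has spectral norm at most 2. -/
theorem spectral_norm_smoothed_ratio_le_two
    (n m : ℕ) (hn : 1 ≤ n) (hm : 1 ≤ m)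
    (p : Matrix (Fin n) (Fin m) ℝ) (hp : IsDistrib p) :
    spNorm (fun i j => p i j / Real.sqrt (smoothR p i * smoothC p j)) ≤ 2 := by
  obtain ⟨h0, -⟩ := hp
  have hn' : (0 : ℝ) < n := by exact_mod_cast hn
  have hm' : (0 : ℝ) < m := by exact_mod_cast hm
  have hr0 : ∀ i, 0 ≤ rowMarg p i := fun i => Finset.sum_nonneg fun j _ => h0 i j
  have hc0 : ∀ j, 0 ≤ colMarg p j := fun j => Finset.sum_nonneg fun i _ => h0 i j
  have ha : ∀ i, 0 < smoothR p i := fun i => by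
    have := hr0 i
    unfold smoothR
    positivity
  have hb : ∀ j, 0 < smoothC p j := fun j => by
    have := hc0 j
    unfold smoothC
    positivity
  have hra : ∀ i, rowMarg p i ≤ 2 * smoothR p i := fun i => by
    have : 0 < 1 / (2 * (n : ℝ)) := by positivity
    unfold smoothR
    linarith
  have hcb : ∀ j, colMarg p j ≤ 2 * smoothC p j := fun j => by
    have : 0 < 1 / (2 * (m : ℝ)) := by positivity
    unfold smoothC
    linarith
  apply Real.sSup_le _ (by norm_num)
  rintro x ⟨u, v, hu, hv, rfl⟩
  have key : ∀ i j, u i * (p i j / Real.sqrt (smoothR p i * smoothC p j)) * v j ≤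
      p i j * (u i ^ 2 / (2 * smoothR p i)) + p i j * (v j ^ 2 / (2 * smoothC p j)) := by
    intro i j
    rw [Real.sqrt_mul (ha i).le]
    have hs := Real.sqrt_pos.2 (ha i)
    have ht := Real.sqrt_pos.2 (hb j)
    have hs2 := Real.sq_sqrt (ha i).le
    have ht2 := Real.sq_sqrt (hb j).le
    have e1 : u i * (p i j / (√(smoothR p i) * √(smoothC p j))) * v j
        = p i j * ((u i / √(smoothR p i)) * (v j / √(smoothC p j))) := by
      field_simp
    have e2 : u i ^ 2 / (2 * smoothR p i) = (u i / √(smoothR p i)) ^ 2 / 2 := by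
      rw [div_pow, hs2, div_div, mul_comm]
    have e3 : v j ^ 2 / (2 * smoothC p j) = (v j / √(smoothC p j)) ^ 2 / 2 := by
      rw [div_pow, ht2, div_div, mul_comm]
    rw [e1, e2, e3, ← mul_add]
    apply mul_le_mul_of_nonneg_left _ (h0 i j)
    nlinarith [sq_nonneg (u i / √(smoothR p i) - v j / √(smoothC p j))]
  have hR : ∑ i, ∑ j, p i j * (u i ^ 2 / (2 * smoothR p i)) ≤ 1 := by
    rw [← hu]
    apply Finset.sum_le_sum
    intro i _
    rw [← Finset.sum_mul]
    have h1 := ha i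
    have h2 := mul_le_mul_of_nonneg_right (hra i)
      (show 0 ≤ u i ^ 2 / (2 * smoothR p i) by positivity)
    rwa [mul_div_cancel₀ _ (by positivity)] at h2
  have hC : ∑ i, ∑ j, p i j * (v j ^ 2 / (2 * smoothC p j)) ≤ 1 := by
    rw [← hv, Finset.sum_comm]
    apply Finset.sum_le_sum
    intro j _
    rw [← Finset.sum_mul]
    have h1 := hb j
    have h2 := mul_le_mul_of_nonneg_right (hcb j)
      (show 0 ≤ v j ^ 2 / (2 * smoothC p j) by positivity)
    rwa [mul_div_cancel₀ _ (by positivity)] at h2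
  have := Finset.sum_le_sum fun i (_ : i ∈ Finset.univ) =>
    Finset.sum_le_sum fun j (_ : j ∈ Finset.univ) => key i j
  simp only [Finset.sum_add_distrib] at this hR hC
  linarith

end
end
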